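/- Let n ≥ 1 and let c ≥ p ≥ 0 be integers. Then, in ℚ(q), the generating function Σ_T q^{n(T)}, summed over all tableaux T with entries in {1,…,n} having at most c columns, exactly p of which are odd, equals q^p · ([p+n−1 ¦ p]_q [c−p+n−1 ¦ c−p]_q / (2 [c+n−1 ¦ c]_q)) · Π_{1≤i<j≤n} ([c+i+j−2]_q/[i+j]_q) · ( Σ_{k=0}^{n} q^{k(k+c−1)} ( q^k [n−1 ¦ k]_q + q^{−p} [n−1 ¦ k−1]_q )^2 + (1−q^{c−2p}) Π_{i=1}^{n−1} (1−q^{c+2i}) ). -/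

import Mathlib

open scoped Classical
open Finset

noncomputable section

/-- The indeterminate `q` of `ℚ(q)`. -/
def qq : RatFunc ℚ := RatFunc.X

/-- `[m]_q! = (1-q)(1-q²)⋯(1-q^m)`. -/
def qFact {F : Type} [Field F] (q : F) (m : ℕ) : F :=
  ∏ i ∈ Finset.range m, (1 - q ^ (i + 1))

/-- The q-binomial coefficient `[m ¦ k]_q` (zero for `k < 0`). -/
def qBinom {F : Type} [Field F] (q : F) (m : ℕ) (k : ℤ) : F :=
  if k < 0 then 0
  else (∏ i ∈ Finset.range k.toNat, (1 - q ^ ((m : ℤ) - (i : ℤ)))) / qFact q k.toNat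

/-- `T : Fin n → Fin c → ℕ` encodes a tableau with at most `n` rows and at most
`c` columns: `0` marks an empty cell; rows are left-justified, columns are
top-justified, rows weakly increase and columns strictly increase. -/
def IsTab (n c : ℕ) (T : Fin n → Fin c → ℕ) : Prop :=
  (∀ i : Fin n, ∀ j j' : Fin c, j ≤ j' → T i j' ≠ 0 → T i j ≠ 0) ∧
  (∀ i i' : Fin n, ∀ j : Fin c, i ≤ i' → T i' j ≠ 0 → T i j ≠ 0) ∧
  (∀ i : Fin n, ∀ j j' : Fin c, j ≤ j' → T i j' ≠ 0 → T i j ≤ T i j') ∧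
  (∀ i i' : Fin n, ∀ j : Fin c, i < i' → T i' j ≠ 0 → T i j < T i' j)

/-- The number of odd columns of (the shape of) the tableau `T`. -/
def oddColsTab (n c : ℕ) (T : Fin n → Fin c → ℕ) : ℕ :=
  (Finset.univ.filter (fun j : Fin c =>
    Odd ((Finset.univ.filter (fun i : Fin n => T i j ≠ 0)).card))).card

/-- `n(T)`: the sum of all entries of the tableau `T`. -/
def sumTab (n c : ℕ) (T : Fin n → Fin c → ℕ) : ℕ := ∑ i, ∑ j, T i j


/-- row lengths of a tableau -/
def shp (n c : ℕ) (T : Fin n → Fin c → ℕ) (i : Fin n) : ℕ :=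
  (univ.filter (fun j : Fin c => T i j ≠ 0)).card

lemma downset_iff {c : ℕ} (P : Fin c → Prop) [DecidablePred P] (h : ∀ j j', j ≤ j' → P j' → P j) (j : Fin c) :
    P j ↔ (j : ℕ) < (univ.filter P).card := by
  constructor
  · intro hj
    have : Finset.Iic j ⊆ univ.filter P := by
      intro k hk
      simp only [mem_filter, mem_univ, true_and]
      exact h k j (by simpa using hk) hj
    have := card_le_card this
    simp at this
    omega
  · intro hj
    by_contra hn
    have : univ.filter P ⊆ Finset.Iio j := by
      intro k hk
      simp only [mem_filter, mem_univ, true_and] at hk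
      simp only [Finset.mem_Iio]
      by_contra hk2
      exact hn (h j k (not_lt.mp hk2) hk)
    have := card_le_card this
    simp at this
    omega

lemma shp_iff {n c : ℕ} {T : Fin n → Fin c → ℕ} (hT : IsTab n c T) (i : Fin n) (j : Fin c) :
    T i j ≠ 0 ↔ (j : ℕ) < shp n c T i :=
  downset_iff (fun j => T i j ≠ 0) (fun j j' h h' => hT.1 i j j' h h') j

lemma card_lt_fin (c k : ℕ) (h : k ≤ c) :
    (univ.filter (fun j : Fin c => (j : ℕ) < k)).card = k := by
  rw [Fin.card_filter_val_lt]; omega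

lemma tab_ge {n c : ℕ} {T : Fin n → Fin c → ℕ} (hT : IsTab n c T) :
    ∀ (k : ℕ) (i : Fin n) (j : Fin c), (i : ℕ) = k → T i j ≠ 0 → k + 1 ≤ T i j := by
  intro k
  induction k with
  | zero => intro i j _ h; omega
  | succ k ih =>
    intro i j hi h
    have hk : k < n := by omega
    have hlt : (⟨k, hk⟩ : Fin n) < i := by rw [Fin.lt_def]; simp; omega
    have h1 := ih ⟨k, hk⟩ j rfl (hT.2.1 _ _ j hlt.le h)
    have h2 := hT.2.2.2 _ _ j hlt h
    omega

/-- tableaux with entries at most `m` -/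
def AT (n c m : ℕ) : Finset (Fin n → Fin c → ℕ) :=
  (Fintype.piFinset fun _ : Fin n =>
          Fintype.piFinset fun _ : Fin c => Finset.range (m + 1)).filter (fun T => IsTab n c T)

lemma mem_AT {n c m : ℕ} {T : Fin n → Fin c → ℕ} :
    T ∈ AT n c m ↔ (∀ i j, T i j ≤ m) ∧ IsTab n c T := by
  simp [AT, Fintype.mem_piFinset]

/-- generating function of tableaux of fixed shape -/
def Z {F : Type} [Field F] (q : F) (n c m : ℕ) (l : Fin n → ℕ) : F :=
  ∑ T ∈ (AT n c m).filter (fun T => shp n c T = l), q ^ sumTab n c T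

/-- next part -/
def nxt {n : ℕ} (l : Fin n → ℕ) (i : Fin n) : ℕ :=
  if h : (i : ℕ) + 1 < n then l ⟨i + 1, h⟩ else 0

def rem (n c m : ℕ) (T : Fin n → Fin c → ℕ) : Fin n → Fin c → ℕ :=
  fun i j => if T i j = m + 1 then 0 else T i j

def addl (n c m : ℕ) (l : Fin n → ℕ) (T : Fin n → Fin c → ℕ) : Fin n → Fin c → ℕ :=
  fun i j => if T i j ≠ 0 then T i j else if (j : ℕ) < l i then m + 1 else 0

lemma rem_mem {n c m : ℕ} {T : Fin n → Fin c → ℕ} (hT : T ∈ AT n c (m + 1)) :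
    rem n c m T ∈ AT n c m := by
  rw [mem_AT] at hT ⊢
  obtain ⟨hb, h1, h2, h3, h4⟩ := hT
  unfold rem
  refine ⟨?_, ?_, ?_, ?_, ?_⟩
  · intro i j
    have := hb i j
    split_ifs <;> omega
  · intro i j j' hj h
    have a := h1 i j j' hj; have b := h3 i j j' hj; have d := hb i j'
    grind
  · intro i i' j hi h
    have a := h2 i i' j hi
    rcases hi.eq_or_lt with rfl | hi
    · exact h
    have b := h4 i i' j hi; have d := hb i' j
    grind
  · intro i j j' hj h
    have a := h1 i j j' hj; have b := h3 i j j' hj; have d := hb i j'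
    grind
  · intro i i' j hi h
    have a := h2 i i' j hi.le
    have b := h4 i i' j hi; have d := hb i' j
    grind

lemma rem_shp {n c m : ℕ} {T : Fin n → Fin c → ℕ} (hT : T ∈ AT n c (m + 1)) (i : Fin n) :
    nxt (shp n c T) i ≤ shp n c (rem n c m T) i ∧ shp n c (rem n c m T) i ≤ shp n c T i := by
  rw [mem_AT] at hT
  obtain ⟨hb, hT⟩ := hT
  constructor
  · unfold nxt
    split_ifs with h
    · refine card_le_card ?_
      intro j
      simp only [mem_filter, mem_univ, true_and]
      unfold rem
      intro hj
      have a := hT.2.1 i ⟨i+1, h⟩ j (by rw [Fin.le_def]; simp) hj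
      have b := hT.2.2.2 i ⟨i+1, h⟩ j (by rw [Fin.lt_def]; simp) hj
      have d := hb ⟨i+1, h⟩ j
      rw [if_neg (by omega)]
      exact a
    · exact Nat.zero_le _
  · refine card_le_card ?_
    intro j
    simp only [mem_filter, mem_univ, true_and]
    unfold rem
    grind

lemma addl_ne {n c m : ℕ} {T : Fin n → Fin c → ℕ} (hT : IsTab n c T) (l : Fin n → ℕ)
    (hl : ∀ i, shp n c T i ≤ l i) (i : Fin n) (j : Fin c) :
    addl n c m l T i j ≠ 0 ↔ (j : ℕ) < l i := by
  unfold addl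
  have a := shp_iff hT i j
  have b := hl i
  by_cases h : T i j = 0
  · simp [h]
  · simp only [ne_eq, h, not_false_eq_true, ite_true, true_iff]
    have := a.1 h
    omega

lemma addl_mem {n c m : ℕ} {T : Fin n → Fin c → ℕ} (hT : T ∈ AT n c m) (l : Fin n → ℕ)
    (hl : Antitone l) (hl2 : ∀ i, nxt l i ≤ shp n c T i ∧ shp n c T i ≤ l i) :
    addl n c m l T ∈ AT n c (m + 1) := by
  rw [mem_AT] at hT ⊢
  obtain ⟨hb, hT⟩ := hT
  have hne := fun i j => addl_ne (m := m) hT l (fun i => (hl2 i).2) i j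
  refine ⟨?_, ?_, ?_, ?_, ?_⟩
  · intro i j
    have := hb i j
    unfold addl
    split_ifs <;> omega
  · intro i j j' hj h
    rw [hne] at h ⊢
    have : (j : ℕ) ≤ j' := hj
    omega
  · intro i i' j hi h
    rw [hne] at h ⊢
    have := hl hi
    omega
  · intro i j j' hj h
    have a := hT.2.2.1 i j j' hj; have b := hb i j; have d := hT.1 i j j' hj
    unfold addl at h ⊢
    grind
  · intro i i' j hi h
    have a := hT.2.2.2 i i' j hi; have b := hb i j; have d := hT.2.1 i i' j hi.le
    by_cases h' : T i' j = 0
    · have h1 := (hne i' j).1 h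
      have hin : (i : ℕ) + 1 < n := by have : (i:ℕ) < i' := hi; omega
      have h2 : l i' ≤ l ⟨i+1, hin⟩ := hl (by rw [Fin.le_def]; simpa using hi)
      have h3 := (hl2 i).1
      unfold nxt at h3
      rw [dif_pos hin] at h3
      have h4 := (shp_iff hT i j).2 (by omega)
      unfold addl
      rw [if_pos h4, if_neg (by simpa using h'), if_pos h1]
      omega
    · unfold addl
      rw [if_pos (d h'), if_pos h']
      exact a h'

lemma addl_shp {n c m : ℕ} {T : Fin n → Fin c → ℕ} (hT : T ∈ AT n c m) (l : Fin n → ℕ)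
    (hc : ∀ i, l i ≤ c) (hl2 : ∀ i, nxt l i ≤ shp n c T i ∧ shp n c T i ≤ l i) :
    shp n c (addl n c m l T) = l := by
  rw [mem_AT] at hT
  funext i
  conv_rhs => rw [← card_lt_fin c (l i) (hc i)]
  unfold shp
  congr 1
  ext j
  simp only [mem_filter, mem_univ, true_and]
  exact addl_ne hT.2 l (fun i => (hl2 i).2) i j

lemma rem_sum {n c m : ℕ} {T : Fin n → Fin c → ℕ} (hT : T ∈ AT n c (m + 1)) :
    sumTab n c T = sumTab n c (rem n c m T) +
      (m + 1) * (∑ i, shp n c T i - ∑ i, shp n c (rem n c m T) i) := by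
  have key : ∀ i, ∑ j, T i j + (m + 1) * shp n c (rem n c m T) i =
      ∑ j, rem n c m T i j + (m + 1) * shp n c T i := by
    intro i
    unfold shp
    rw [card_filter, card_filter, mul_sum, mul_sum, ← sum_add_distrib, ← sum_add_distrib]
    refine sum_congr rfl fun j _ => ?_
    unfold rem
    grind
  have h2 : ∑ i, shp n c (rem n c m T) i ≤ ∑ i, shp n c T i :=
    sum_le_sum fun i _ => (rem_shp hT i).2
  have h3 : sumTab n c T + (m + 1) * ∑ i, shp n c (rem n c m T) i =
      sumTab n c (rem n c m T) + (m + 1) * ∑ i, shp n c T i := by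
    unfold sumTab
    rw [mul_sum, mul_sum, ← sum_add_distrib, ← sum_add_distrib]
    exact sum_congr rfl fun i _ => key i
  obtain ⟨d, hd⟩ := Nat.exists_eq_add_of_le h2
  rw [hd] at h3 ⊢
  rw [Nat.add_sub_cancel_left]
  rw [mul_add] at h3
  omega

lemma Z_succ {F : Type} [Field F] (q : F) (n c m : ℕ) (l : Fin n → ℕ) (hl : Antitone l)
    (hc : ∀ i, l i ≤ c) :
    Z q n c (m + 1) l = ∑ μ ∈ Fintype.piFinset (fun i => Finset.Icc (nxt l i) (l i)),
      Z q n c m μ * q ^ ((m + 1) * (∑ i, l i - ∑ i, μ i)) := by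
  have h1 : ∑ μ ∈ Fintype.piFinset (fun i => Finset.Icc (nxt l i) (l i)),
      Z q n c m μ * q ^ ((m + 1) * (∑ i, l i - ∑ i, μ i)) =
      ∑ T ∈ (AT n c m).filter
        (fun T => shp n c T ∈ Fintype.piFinset (fun i => Finset.Icc (nxt l i) (l i))),
        q ^ sumTab n c T * q ^ ((m + 1) * (∑ i, l i - ∑ i, shp n c T i)) := by
    rw [← sum_fiberwise_of_maps_to (g := shp n c)
      (t := Fintype.piFinset (fun i => Finset.Icc (nxt l i) (l i)))]
    · refine sum_congr rfl fun μ hμ => ?_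
      unfold Z
      rw [sum_mul, filter_filter]
      refine sum_congr ?_ ?_
      · ext T
        simp only [mem_filter]
        constructor
        · rintro ⟨a, rfl⟩; exact ⟨a, hμ, rfl⟩
        · rintro ⟨a, _, b⟩; exact ⟨a, b⟩
      · intro T hT
        rw [(mem_filter.1 hT).2.2]
    · intro T hT
      exact (mem_filter.1 hT).2
  rw [h1]
  unfold Z
  have hmem : ∀ μ : Fin n → ℕ, μ ∈ Fintype.piFinset (fun i => Finset.Icc (nxt l i) (l i)) ↔
      ∀ i, nxt l i ≤ μ i ∧ μ i ≤ l i := by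
    intro μ; simp [Fintype.mem_piFinset]
  refine sum_bij' (fun T _ => rem n c m T) (fun T _ => addl n c m l T) ?_ ?_ ?_ ?_ ?_
  · intro T hT
    rw [mem_filter] at hT ⊢
    obtain ⟨hT, rfl⟩ := hT
    exact ⟨rem_mem hT, (hmem _).2 fun i => rem_shp hT i⟩
  · intro T hT
    rw [mem_filter, hmem] at hT
    rw [mem_filter]
    exact ⟨addl_mem hT.1 l hl hT.2, addl_shp hT.1 l hc hT.2⟩
  · intro T hT
    rw [mem_filter] at hT
    obtain ⟨hT, rfl⟩ := hT
    funext i j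
    have a := shp_iff (mem_AT.1 hT).2 i j
    unfold addl rem
    grind
  · intro T hT
    rw [mem_filter, hmem] at hT
    funext i j
    have a := (mem_AT.1 hT.1).1 i j
    unfold addl rem
    grind
  · intro T hT
    rw [mem_filter] at hT
    obtain ⟨hT, rfl⟩ := hT
    rw [← pow_add, ← rem_sum hT]

lemma Z_zero_of {F : Type} [Field F] (q : F) (n c m : ℕ) (l : Fin n → ℕ) (i : Fin n)
    (hi : m ≤ i) (h : l i ≠ 0) : Z q n c m l = 0 := by
  unfold Z
  apply sum_eq_zero
  intro T hT
  exfalso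
  rw [mem_filter, mem_AT] at hT
  obtain ⟨⟨hb, hT⟩, rfl⟩ := hT
  unfold shp at h
  obtain ⟨j, hj⟩ := card_ne_zero.1 h
  simp only [mem_filter, mem_univ, true_and] at hj
  have := tab_ge hT i i j rfl hj
  have := hb i j
  omega

lemma Z_base {F : Type} [Field F] (q : F) (n c : ℕ) : Z q n c 0 (fun _ => 0) = 1 := by
  unfold Z
  have : (AT n c 0).filter (fun T => shp n c T = fun _ => 0) = {fun _ _ => 0} := by
    ext T
    rw [mem_filter, mem_AT, mem_singleton]
    constructor
    · rintro ⟨⟨h, _⟩, _⟩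
      funext i j
      simpa using h i j
    · rintro rfl
      refine ⟨⟨by simp, by simp [IsTab]⟩, ?_⟩
      funext i
      simp [shp]
  rw [this, sum_singleton]
  simp [sumTab]

/-- numerator determinant -/
def bial {F : Type} [Field F] {m : ℕ} (x : Fin m → F) (l : Fin m → ℕ) : F :=
  Matrix.det (Matrix.of fun i j : Fin m => x j ^ (l i + (m - 1 - (i : ℕ))))

/-- Vandermonde product -/
def Vd {F : Type} [Field F] {m : ℕ} (x : Fin m → F) : F :=
  ∏ i, ∏ j, if i < j then x i - x j else 1

lemma geom_row {F : Type} [Field F] (x y : F) (a b e : ℕ) (h : b ≤ a) :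
    (x - y) * ∑ k ∈ Finset.Icc b a, x ^ (k + e) * y ^ (a - k) =
      x ^ (a + 1 + e) - x ^ (b + e) * y ^ (a - b + 1) := by
  obtain ⟨d, rfl⟩ := Nat.exists_eq_add_of_le h
  induction d with
  | zero => simp; ring
  | succ d ih =>
    have h1 : b + (d + 1) = (b + d) + 1 := by ring
    rw [h1, Finset.sum_Icc_succ_top (by omega), mul_add]
    have h2 : ∑ k ∈ Finset.Icc b (b + d), x ^ (k + e) * y ^ (b + d + 1 - k) =
        y * ∑ k ∈ Finset.Icc b (b + d), x ^ (k + e) * y ^ (b + d - k) := by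
      rw [mul_sum]
      refine sum_congr rfl fun k hk => ?_
      rw [Finset.mem_Icc] at hk
      rw [show b + d + 1 - k = (b + d - k) + 1 by omega]
      ring
    rw [h2, mul_left_comm, ih (by omega)]
    rw [show b + d - b = d by omega, show b + d + 1 - b = d + 1 by omega]
    simp
    ring

lemma bial_rowop {F : Type} [Field F] {m : ℕ} (x : Fin (m + 1) → F) (l : Fin (m + 1) → ℕ)
    (hl : Antitone l) :
    bial x l = x (Fin.last m) ^ l (Fin.last m) *
      Matrix.det (Matrix.of fun i j : Fin m =>
        x j.castSucc ^ (l i.castSucc + 1 + (m - 1 - (i : ℕ))) -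
        x j.castSucc ^ (l i.succ + (m - 1 - (i : ℕ))) *
          x (Fin.last m) ^ (l i.castSucc - l i.succ + 1)) := by
  set A : Matrix (Fin (m + 1)) (Fin (m + 1)) F :=
    Matrix.of fun i j => x j ^ (l i + (m + 1 - 1 - (i : ℕ))) with hA
  set cc : Fin m → F := fun i => x (Fin.last m) ^ (l i.castSucc - l i.succ + 1) with hcc
  set B : Matrix (Fin (m + 1)) (Fin (m + 1)) F :=
    Matrix.of (Fin.lastCases (fun j => A (Fin.last m) j)
      (fun i j => A i.castSucc j - cc i * A i.succ j)) with hB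
  have hBl : ∀ j, B (Fin.last m) j = A (Fin.last m) j := by intro j; simp [hB]
  have hBc : ∀ i j, B (Fin.castSucc i) j = A i.castSucc j - cc i * A i.succ j := by
    intro i j; simp [hB]
  have h1 : A.det = B.det := by
    rw [← Matrix.det_submatrix_equiv_self Fin.revPerm A,
      ← Matrix.det_submatrix_equiv_self Fin.revPerm B]
    apply Matrix.det_eq_of_forall_row_eq_smul_add_pred (fun i => cc (Fin.rev i))
    · intro j
      simp [hBl]
    · intro i j
      simp only [Matrix.submatrix_apply, Fin.revPerm_apply, Fin.rev_succ, Fin.rev_castSucc, hBc]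
      ring
  have h2 : bial x l = A.det := rfl
  rw [h2, h1, Matrix.det_succ_column B (Fin.last m), Fin.sum_univ_castSucc]
  have hz : ∀ i : Fin m, B i.castSucc (Fin.last m) = 0 := by
    intro i
    rw [hBc]
    simp only [hA, hcc, Matrix.of_apply, ← pow_add]
    rw [sub_eq_zero]
    congr 1
    have := hl (Fin.castSucc_lt_succ (i := i)).le
    simp
    omega
  simp only [hz, mul_zero, zero_mul, sum_const_zero, zero_add]
  rw [hBl]
  have hs : ((-1 : F)) ^ (((Fin.last m : Fin (m+1)) : ℕ) + ((Fin.last m : Fin (m+1)) : ℕ)) = 1 := by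
    exact Even.neg_one_pow ⟨_, rfl⟩
  rw [hs, one_mul]
  congr 1
  · simp [hA]
  · congr 1
    ext i j
    simp only [Matrix.submatrix_apply, Fin.succAbove_last, hBc, hA, hcc, Matrix.of_apply]
    congr 1
    · congr 1
      simp
      omega
    · rw [mul_comm]
      congr 2
      simp
      omega

lemma bial_branch {F : Type} [Field F] {m : ℕ} (x : Fin (m + 1) → F) (l : Fin (m + 1) → ℕ)
    (hl : Antitone l) :
    bial x l = (∏ j : Fin m, (x j.castSucc - x (Fin.last m))) *
      ∑ μ ∈ Fintype.piFinset (fun i : Fin m => Finset.Icc (l i.succ) (l i.castSucc)),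
        bial (fun j : Fin m => x j.castSucc) μ * x (Fin.last m) ^ (∑ i, l i - ∑ i, μ i) := by
  have hle : ∀ i : Fin m, l i.succ ≤ l i.castSucc := fun i =>
    hl (Fin.castSucc_lt_succ (i := i)).le
  have h1 : ∀ μ ∈ Fintype.piFinset (fun i : Fin m => Finset.Icc (l i.succ) (l i.castSucc)),
      bial (fun j : Fin m => x j.castSucc) μ * x (Fin.last m) ^ (∑ i, l i - ∑ i, μ i) =
      x (Fin.last m) ^ l (Fin.last m) * Matrix.detRowAlternating (R := F)
        (fun i j : Fin m => x j.castSucc ^ (μ i + (m - 1 - (i : ℕ))) *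
          x (Fin.last m) ^ (l i.castSucc - μ i)) := by
    intro μ hμ
    rw [Fintype.mem_piFinset] at hμ
    have e : ∑ i, l i - ∑ i, μ i = l (Fin.last m) + ∑ i : Fin m, (l i.castSucc - μ i) := by
      have : ∑ i : Fin m, (l i.castSucc - μ i) + ∑ i, μ i = ∑ i : Fin m, l i.castSucc := by
        rw [← sum_add_distrib]
        refine sum_congr rfl fun i _ => ?_
        have := Finset.mem_Icc.1 (hμ i)
        omega
      rw [Fin.sum_univ_castSucc]
      omega
    have := Matrix.det_mul_column (fun i : Fin m => x (Fin.last m) ^ (l i.castSucc - μ i))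
      (Matrix.of fun i j : Fin m => x j.castSucc ^ (μ i + (m - 1 - (i : ℕ))))
    rw [e, pow_add, ← prod_pow_eq_pow_sum]
    unfold bial
    rw [mul_comm, mul_assoc, ← this]
    congr 1
    change Matrix.det _ = Matrix.det _
    congr 1
    ext i j
    simp [mul_comm]
  rw [sum_congr rfl h1, ← mul_sum]
  have h2 := MultilinearMap.map_sum_finset
    (Matrix.detRowAlternating (R := F) (n := Fin m)).toMultilinearMap
    (fun (i : Fin m) (k : ℕ) => fun j : Fin m => x j.castSucc ^ (k + (m - 1 - (i : ℕ))) *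
          x (Fin.last m) ^ (l i.castSucc - k))
    (fun i : Fin m => Finset.Icc (l i.succ) (l i.castSucc))
  simp only [AlternatingMap.coe_multilinearMap] at h2
  rw [← h2, bial_rowop x l hl, mul_left_comm]
  congr 1
  have h3 := Matrix.det_mul_row (fun j : Fin m => x j.castSucc - x (Fin.last m))
    (Matrix.of fun (i j : Fin m) => ∑ k ∈ Finset.Icc (l i.succ) (l i.castSucc),
      x j.castSucc ^ (k + (m - 1 - (i : ℕ))) * x (Fin.last m) ^ (l i.castSucc - k))
  have h4 : (Matrix.detRowAlternating (R := F) (n := Fin m))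
      (fun i => ∑ k ∈ Finset.Icc (l i.succ) (l i.castSucc), fun j : Fin m =>
        x j.castSucc ^ (k + (m - 1 - (i : ℕ))) * x (Fin.last m) ^ (l i.castSucc - k)) =
      Matrix.det (Matrix.of fun (i j : Fin m) => ∑ k ∈ Finset.Icc (l i.succ) (l i.castSucc),
      x j.castSucc ^ (k + (m - 1 - (i : ℕ))) * x (Fin.last m) ^ (l i.castSucc - k)) := by
    change Matrix.det _ = Matrix.det _
    congr 1
    ext i j
    rw [Finset.sum_apply]
    rfl
  rw [h4, ← h3]
  congr 1
  ext i j
  simp only [Matrix.of_apply]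
  rw [geom_row _ _ _ _ _ (hle i)]

lemma Vd_castSucc {F : Type} [Field F] {m : ℕ} (x : Fin (m + 1) → F) :
    Vd x = Vd (fun j : Fin m => x j.castSucc) * ∏ j : Fin m, (x j.castSucc - x (Fin.last m)) := by
  unfold Vd
  rw [Fin.prod_univ_castSucc, ← prod_mul_distrib]
  have : (∏ j, if Fin.last m < j then x (Fin.last m) - x j else 1) = 1 := by
    apply prod_eq_one
    intro j _
    rw [if_neg (not_lt.2 (Fin.le_last j))]
  rw [this, mul_one]
  refine prod_congr rfl fun i _ => ?_
  rw [Fin.prod_univ_castSucc, if_pos (Fin.castSucc_lt_last i)]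
  simp

/-- extension by zero to `Fin n` -/
def ext0 {m : ℕ} (n : ℕ) (μ : Fin m → ℕ) (i : Fin n) : ℕ :=
  if h : (i : ℕ) < m then μ ⟨i, h⟩ else 0

lemma sum_ext0 {m n : ℕ} (h : m ≤ n) (μ : Fin m → ℕ) : ∑ i : Fin n, ext0 n μ i = ∑ i, μ i := by
  obtain ⟨d, rfl⟩ := Nat.exists_eq_add_of_le h
  rw [Fin.sum_univ_add]
  simp [ext0]

lemma ext0_antitone {m n : ℕ} (μ : Fin m → ℕ) (hμ : Antitone μ) : Antitone (ext0 n μ) := by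
  intro i j hij
  have hij' : (i : ℕ) ≤ j := hij
  unfold ext0
  split_ifs with h1 h2
  · exact hμ (by rw [Fin.le_def]; exact hij')
  · omega
  · omega
  · exact le_rfl

lemma Z_bial {F : Type} [Field F] (q : F) (n c : ℕ) : ∀ (m : ℕ), m ≤ n → ∀ (l : Fin m → ℕ),
    Antitone l → (∀ i, l i ≤ c) →
    Z q n c m (ext0 n l) * Vd (fun j : Fin m => q ^ ((j : ℕ) + 1)) =
      bial (fun j : Fin m => q ^ ((j : ℕ) + 1)) l := by
  intro m
  induction m with
  | zero =>
    intro _ l _ _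
    have : ext0 n l = fun _ => 0 := by funext i; simp [ext0]
    rw [this, Z_base]
    simp [Vd, bial]
  | succ m ih =>
    intro hm l hl hc
    rw [Z_succ q n c m _ (ext0_antitone l hl) (by intro i; unfold ext0; split_ifs; exact hc _; omega),
      bial_branch _ _ hl, Vd_castSucc]
    have hsum : ∑ μ ∈ Fintype.piFinset (fun i => Finset.Icc (nxt (ext0 n l) i) (ext0 n l i)),
        Z q n c m μ * q ^ ((m + 1) * (∑ i, ext0 n l i - ∑ i, μ i)) =
        ∑ μ ∈ Fintype.piFinset (fun i : Fin m => Finset.Icc (l i.succ) (l i.castSucc)),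
          Z q n c m (ext0 n μ) * q ^ ((m + 1) * (∑ i, l i - ∑ i, μ i)) := by
      symm
      refine sum_of_injOn (fun μ => ext0 n μ) ?_ ?_ ?_ ?_
      · intro μ _ ν _ h
        funext i
        have := congrFun h ⟨i, by omega⟩
        simpa [ext0] using this
      · intro μ hμ
        simp only [mem_coe, Fintype.mem_piFinset, Finset.mem_Icc] at hμ ⊢
        intro i
        unfold nxt ext0
        by_cases hi : (i : ℕ) < m
        · have := hμ ⟨i, hi⟩
          simp only [hi, dif_pos, show (i : ℕ) < m + 1 by omega, show (i : ℕ) + 1 < m + 1 by omega,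
            show (i : ℕ) + 1 < n by omega]
          exact this
        · simp only [hi]
          simp
          intro _ h
          exact absurd h hi
      · intro μ hμ hn
        rw [mul_eq_zero]; left
        by_contra hz
        apply hn
        have h0 : ∀ i : Fin n, m ≤ i → μ i = 0 := by
          intro i hi
          by_contra h
          exact hz (Z_zero_of q n c m μ i hi h)
        refine ⟨fun i => μ ⟨i, by omega⟩, ?_, ?_⟩
        · simp only [mem_coe, Fintype.mem_piFinset, Finset.mem_Icc] at hμ ⊢
          intro i
          have := hμ ⟨i, by omega⟩
          unfold nxt ext0 at this
          simp only [show (i : ℕ) < m + 1 by omega, show (i : ℕ) + 1 < m + 1 by omega,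
            show (i : ℕ) + 1 < n by omega, dif_pos] at this
          exact this
        · funext i
          simp only [ext0]
          split_ifs with h
          · rfl
          · exact (h0 i (by omega)).symm
      · intro μ _
        rw [sum_ext0 hm, sum_ext0 (by omega)]
    rw [hsum, mul_comm _ (∏ j : Fin m, _), mul_left_comm, sum_mul]
    congr 1
    refine sum_congr rfl fun μ hμ => ?_
    rw [Fintype.mem_piFinset] at hμ
    have hμa : Antitone μ := by
      intro i j hij
      rcases hij.eq_or_lt with rfl | hij
      · exact le_rfl
      have h1 := (Finset.mem_Icc.1 (hμ j)).2
      have h2 := (Finset.mem_Icc.1 (hμ i)).1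
      have h3 : l j.castSucc ≤ l i.succ := hl (by
        have : (i : ℕ) < j := hij
        rw [Fin.le_def]; simp; omega)
      omega
    have := ih (by omega) μ hμa (fun i => (Finset.mem_Icc.1 (hμ i)).2.trans (hc _))
    simp only [Fin.val_castSucc, Fin.val_last]
    rw [← this, pow_mul]
    ring

lemma alt_sum_lt (n h : ℕ) (hh : h ≤ n) :
    ∑ i : Fin n, (if (i : ℕ) < h then (-1 : ℤ) ^ (i : ℕ) else 0) = if Odd h then 1 else 0 := by
  rw [Fin.sum_univ_eq_sum_range (fun i => if i < h then (-1 : ℤ) ^ i else 0) n]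
  rw [← sum_filter]
  have : (range n).filter (fun i => i < h) = range h := by
    ext i; simp; omega
  rw [this, neg_one_geom_sum]
  by_cases h : Even h
  · rw [if_pos h, if_neg (by simpa using h)]
  · rw [if_neg h, if_pos (by simpa using h)]

lemma oddCols_eq {n c : ℕ} {T : Fin n → Fin c → ℕ} (hT : IsTab n c T) :
    (oddColsTab n c T : ℤ) = ∑ i : Fin n, (-1 : ℤ) ^ (i : ℕ) * (shp n c T i : ℤ) := by
  unfold oddColsTab shp
  simp only [card_filter]
  push_cast
  simp only [mul_sum]
  rw [sum_comm]
  refine sum_congr rfl fun j _ => ?_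
  have hd := fun i => downset_iff (fun i : Fin n => T i j ≠ 0)
    (fun i i' h h' => hT.2.1 i i' j h h') i
  have h2 := alt_sum_lt n (univ.filter (fun i : Fin n => T i j ≠ 0)).card
    ((card_le_univ _).trans (by simp))
  rw [card_filter] at h2
  rw [← h2]
  refine sum_congr rfl fun i _ => ?_
  have hd' := hd i
  simp only [card_filter] at hd'
  by_cases h : T i j = 0
  · rw [if_neg (by rw [← hd']; simpa using h)]; simp [h]
  · rw [if_pos (by rw [← hd']; exact h)]; simp [h]

/-- admissible shapes -/
def Lset (n a b : ℕ) : Finset (Fin n → ℕ) :=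
  (Fintype.piFinset fun _ : Fin n => range (a + b + 1)).filter
    (fun l => Antitone l ∧ ∑ i : Fin n, (-1 : ℤ) ^ (i : ℕ) * (l i : ℤ) = a)

lemma mem_Lset {n a b : ℕ} {l : Fin n → ℕ} : l ∈ Lset n a b ↔ (∀ i, l i ≤ a + b) ∧ Antitone l ∧
    ∑ i : Fin n, (-1 : ℤ) ^ (i : ℕ) * (l i : ℤ) = a := by
  simp [Lset, Fintype.mem_piFinset]

lemma shp_antitone {n c : ℕ} {T : Fin n → Fin c → ℕ} (hT : IsTab n c T) :
    Antitone (shp n c T) := by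
  intro i i' h
  refine card_le_card ?_
  intro j
  simp only [mem_filter, mem_univ, true_and]
  exact hT.2.1 i i' j h

lemma start {F : Type} [Field F] (q : F) (n a b : ℕ) :
    (∑ T ∈ ((Fintype.piFinset fun _ : Fin n =>
          Fintype.piFinset fun _ : Fin (a + b) => Finset.range (n + 1)).filter
        (fun T => IsTab n (a + b) T ∧ oddColsTab n (a + b) T = a)),
      q ^ sumTab n (a + b) T) = ∑ l ∈ Lset n a b, Z q n (a + b) n l := by
  rw [← sum_fiberwise_of_maps_to (g := shp n (a + b)) (t := Lset n a b)]
  · refine sum_congr rfl fun l hl => ?_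
    unfold Z AT
    refine sum_congr ?_ fun _ _ => rfl
    ext T
    simp only [mem_filter]
    constructor
    · rintro ⟨⟨h1, h2, h3⟩, h4⟩; exact ⟨⟨h1, h2⟩, h4⟩
    · rintro ⟨⟨h1, h2⟩, rfl⟩
      refine ⟨⟨h1, h2, ?_⟩, rfl⟩
      have := (mem_Lset.1 hl).2.2
      rw [← oddCols_eq h2] at this
      exact_mod_cast this
  · intro T hT
    rw [mem_filter] at hT
    rw [mem_Lset]
    refine ⟨?_, shp_antitone hT.2.1, ?_⟩
    · intro i
      exact (card_le_univ _).trans (by simp)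
    · rw [← oddCols_eq hT.2.1, hT.2.2]

lemma alt_bound : ∀ (n : ℕ) (l : Fin n → ℕ), Antitone l → ∀ m : ℕ, (∀ i, l i ≤ m) →
    0 ≤ ∑ i : Fin n, (-1 : ℤ) ^ (i : ℕ) * (l i : ℤ) ∧
    ∑ i : Fin n, (-1 : ℤ) ^ (i : ℕ) * (l i : ℤ) ≤ m := by
  intro n
  induction n with
  | zero => intro l _ m _; simp
  | succ n ih =>
    intro l hl m hm
    have h := ih (fun i => l i.succ) (fun i j hij => hl (Fin.succ_le_succ_iff.2 hij)) (l 0)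
      (fun i => hl (Fin.zero_le _))
    rw [Fin.sum_univ_succ]
    have e : ∑ i : Fin n, (-1 : ℤ) ^ ((i.succ : Fin (n+1)) : ℕ) * (l i.succ : ℤ) =
        - ∑ i : Fin n, (-1 : ℤ) ^ (i : ℕ) * (l i.succ : ℤ) := by
      rw [← sum_neg_distrib]
      refine sum_congr rfl fun i _ => ?_
      simp [pow_succ]
    rw [e]
    have := hm 0
    simp
    constructor
    · linarith [h.2]
    · have : (l 0 : ℤ) ≤ m := by exact_mod_cast this
      linarith [h.1]

lemma Lset_succ {M : Type} [AddCommMonoid M] (n a b : ℕ) (f : (Fin (n + 1) → ℕ) → M) :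
    ∑ l ∈ Lset (n + 1) a b, f l =
      ∑ d ∈ range (b + 1), ∑ μ ∈ Lset n d a, f (Fin.cons (a + d) μ) := by
  rw [sum_sigma']
  have alt_cons : ∀ (l : Fin (n + 1) → ℕ), ∑ i : Fin (n+1), (-1 : ℤ) ^ (i : ℕ) * (l i : ℤ) =
      l 0 - ∑ i : Fin n, (-1 : ℤ) ^ (i : ℕ) * (l i.succ : ℤ) := by
    intro l
    rw [Fin.sum_univ_succ, sub_eq_add_neg, ← sum_neg_distrib]
    congr 1
    · simp
    · refine sum_congr rfl fun i _ => ?_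
      simp [pow_succ]
  symm
  refine sum_bij' (fun p _ => Fin.cons (a + p.1) p.2)
    (fun l _ => ⟨l 0 - a, fun i => l i.succ⟩) ?_ ?_ ?_ ?_ ?_
  · rintro ⟨d, μ⟩ h
    rw [mem_sigma, mem_range, mem_Lset] at h
    rw [mem_Lset]
    obtain ⟨h0, h1, h2, h3⟩ := h
    simp only at h0 h1 h2 h3 ⊢
    refine ⟨?_, ?_, ?_⟩
    · intro i
      refine Fin.cases ?_ (fun i => ?_) i
      · simp; omega
      · have := h1 i; simp; omega
    · intro i j
      refine Fin.cases ?_ (fun i => ?_) i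
      · refine Fin.cases ?_ (fun j => ?_) j
        · intro _; exact le_rfl
        · intro _
          have := h1 j; simp; omega
      · refine Fin.cases ?_ (fun j => ?_) j
        · intro h; exact absurd h (by simp)
        · intro h
          simp only [Fin.cons_succ]
          exact h2 (Fin.succ_le_succ_iff.1 h)
    · rw [alt_cons]
      simp only [Fin.cons_zero, Fin.cons_succ, h3]
      push_cast; ring
  · intro l h
    rw [mem_Lset] at h
    obtain ⟨h1, h2, h3⟩ := h
    have hanti : Antitone (fun i : Fin n => l i.succ) :=
      fun i j hij => h2 (Fin.succ_le_succ_iff.2 hij)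
    have hb := alt_bound n (fun i => l i.succ) hanti (l 0) (fun i => h2 (Fin.zero_le _))
    rw [alt_cons] at h3
    have h10 := h1 0
    rw [mem_sigma, mem_range, mem_Lset]
    simp only
    refine ⟨by omega, ?_, hanti, ?_⟩
    · intro i
      have : l i.succ ≤ l 0 := h2 (Fin.zero_le _)
      omega
    · omega
  · rintro ⟨d, μ⟩ h
    simp
  · intro l h
    rw [mem_Lset] at h
    obtain ⟨h1, h2, h3⟩ := h
    have hanti : Antitone (fun i : Fin n => l i.succ) :=
      fun i j hij => h2 (Fin.succ_le_succ_iff.2 hij)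
    have hb := alt_bound n (fun i => l i.succ) hanti (l 0) (fun i => h2 (Fin.zero_le _))
    rw [alt_cons] at h3
    funext i
    refine Fin.cases ?_ (fun i => ?_) i
    · simp; omega
    · simp
  · rintro ⟨d, μ⟩ h
    rfl

lemma Vd_succAbove {F : Type} [Field F] {n : ℕ} (x : Fin (n + 1) → F) (k : Fin (n + 1)) :
    Vd x = (-1) ^ (k : ℕ) * (∏ i : Fin n, (x k - x (k.succAbove i))) *
      Vd (fun i => x (k.succAbove i)) := by
  unfold Vd
  rw [Fin.prod_univ_succAbove _ k, Fin.prod_univ_succAbove _ k]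
  simp only [lt_self_iff_false, if_false, one_mul]
  have h1 : ∀ i : Fin n, (∏ j, if k.succAbove i < j then x (k.succAbove i) - x j else 1) =
      (if k.succAbove i < k then x (k.succAbove i) - x k else 1) *
      ∏ j : Fin n, if i < j then x (k.succAbove i) - x (k.succAbove j) else 1 := by
    intro i
    rw [Fin.prod_univ_succAbove _ k]
    simp
  simp only [h1, prod_mul_distrib]
  rw [← mul_assoc, ← prod_mul_distrib]
  congr 1
  have h2 : ∀ i : Fin n, ((if k < k.succAbove i then x k - x (k.succAbove i) else 1) *
      if k.succAbove i < k then x (k.succAbove i) - x k else 1) =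
      (if (i : ℕ) < k then -1 else 1) * (x k - x (k.succAbove i)) := by
    intro i
    by_cases h : (i : ℕ) < k
    · have e : k.succAbove i < k := by
        rw [Fin.succAbove_lt_iff_castSucc_lt]; exact h
      rw [if_neg (not_lt.2 e.le), if_pos e, if_pos h]; ring
    · have e : k < k.succAbove i := by
        rw [Fin.lt_succAbove_iff_le_castSucc, Fin.le_def]; simpa using h
      rw [if_neg (not_lt.2 e.le), if_pos e, if_neg h]; ring
  simp only [h2, prod_mul_distrib]
  congr 1
  rw [prod_ite, prod_const, prod_const_one, mul_one, card_lt_fin n k (by omega)]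

/-- recursively defined sum -/
def R {F ι : Type} [Field F] [LinearOrder ι] (x : ι → F) : ℕ → Finset ι → ℕ → ℕ → F
  | 0, _, a, _ => if a = 0 then 1 else 0
  | n + 1, I, a, b => ∑ d ∈ range (b + 1), ∑ j ∈ I, x j ^ (a + d) *
      (∏ i ∈ I.erase j, x j / (x j - x i)) * R x n (I.erase j) d a

lemma Vd_ne {F : Type} [Field F] {n : ℕ} (x : Fin n → F) (hx : Function.Injective x) :
    Vd x ≠ 0 := by
  unfold Vd
  refine prod_ne_zero_iff.2 fun i _ => prod_ne_zero_iff.2 fun j _ => ?_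
  split_ifs with h
  · rw [sub_ne_zero]
    exact fun e => h.ne (hx e)
  · exact one_ne_zero

lemma bial_cons {F : Type} [Field F] {n : ℕ} (x : Fin (n + 1) → F) (hx : Function.Injective x)
    (m : ℕ) (μ : Fin n → ℕ) :
    bial x (Fin.cons m μ) = Vd x * ∑ k, x k ^ m * (∏ i : Fin n, x k / (x k - x (k.succAbove i))) *
      (bial (fun i => x (k.succAbove i)) μ / Vd (fun i => x (k.succAbove i))) := by
  unfold bial
  rw [Matrix.det_succ_row_zero, mul_sum]
  refine sum_congr rfl fun k _ => ?_
  have hV : Vd (fun i => x (k.succAbove i)) ≠ 0 :=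
    Vd_ne _ (hx.comp Fin.succAbove_right_injective)
  have hp : (∏ i : Fin n, (x k - x (k.succAbove i))) ≠ 0 := by
    refine prod_ne_zero_iff.2 fun i _ => ?_
    rw [sub_ne_zero]
    exact fun e => Fin.succAbove_ne k i (hx e).symm
  rw [Vd_succAbove x k, prod_div_distrib, prod_const, card_univ, Fintype.card_fin]
  have e : (Matrix.of fun i j : Fin (n+1) => x j ^ ((Fin.cons m μ : Fin (n+1) → ℕ) i + (n + 1 - 1 - (i : ℕ)))).submatrix
      Fin.succ k.succAbove = Matrix.of fun i j : Fin n =>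
        x (k.succAbove j) ^ (μ i + (n - 1 - (i : ℕ))) := by
    ext i j
    simp only [Matrix.submatrix_apply, Matrix.of_apply, Fin.cons_succ, Fin.val_succ]
    congr 2
    omega
  rw [e]
  simp only [Matrix.of_apply, Fin.cons_zero]
  field_simp
  rw [pow_add]
  simp
  ring

lemma Lsum_R {F ι : Type} [Field F] [LinearOrder ι] (x : ι → F) (hx : Function.Injective x) :
    ∀ (n : ℕ) (e : Fin n ↪ ι) (a b : ℕ),
    ∑ l ∈ Lset n a b, bial (fun j => x (e j)) l =
      Vd (fun j => x (e j)) * R x n (univ.map e) a b := by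
  intro n
  induction n with
  | zero =>
    intro e a b
    by_cases h : a = 0
    · subst h
      have : Lset 0 0 b = {fun i => i.elim0} := by
        ext l
        rw [mem_Lset, mem_singleton]
        constructor
        · intro _; exact Subsingleton.elim _ _
        · intro _
          exact ⟨fun i => i.elim0, fun i => i.elim0, by simp⟩
      rw [this]
      simp [R, bial, Vd]
    · have : Lset 0 a b = ∅ := by
        ext l
        rw [mem_Lset]
        constructor
        · rintro ⟨_, _, h3⟩
          simp at h3
          exact absurd h3.symm (by exact_mod_cast h)
        · intro h3
          simp at h3
      rw [this]
      simp [R, h]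
  | succ n ih =>
    intro e a b
    rw [Lset_succ, R, mul_sum]
    refine sum_congr rfl fun d _ => ?_
    have hinj : Function.Injective (fun j => x (e j)) := hx.comp e.injective
    simp only [bial_cons _ hinj]
    rw [← mul_sum, sum_comm]
    congr 1
    rw [sum_map]
    refine sum_congr rfl fun k _ => ?_
    set e' : Fin n ↪ ι := k.succAboveEmb.trans e with he'
    have hmap : (univ.map e).erase (e k) = univ.map e' := by
      ext i
      simp only [mem_erase, mem_map, mem_univ, true_and]
      constructor
      · rintro ⟨h1, j, rfl⟩
        have : j ≠ k := fun h => h1 (by rw [h])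
        obtain ⟨j', rfl⟩ := Fin.exists_succAbove_eq this
        exact ⟨j', rfl⟩
      · rintro ⟨j, rfl⟩
        refine ⟨?_, k.succAbove j, rfl⟩
        intro h
        exact Fin.succAbove_ne k j (e.injective h)
    rw [hmap, ← mul_sum, prod_map, ← sum_div]
    have := ih e' d a
    have h3 : (fun j => x (e' j)) = fun j => x (e (k.succAbove j)) := rfl
    rw [h3] at this
    rw [this]
    have hV : Vd (fun i => x (e (k.succAbove i))) ≠ 0 :=
      Vd_ne _ (hinj.comp Fin.succAbove_right_injective)
    rw [mul_div_cancel_left₀ _ hV]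
    rfl

lemma lsum_insert {F : Type} [Field F] (s : Finset F) (a : F) (ha : a ∉ s) (g : F → F) :
    ∑ i ∈ insert a s, g i / ∏ j ∈ (insert a s).erase i, (i - j) =
      g a / ∏ j ∈ s, (a - j) + ∑ i ∈ s, g i / (i - a) / ∏ j ∈ s.erase i, (i - j) := by
  rw [sum_insert ha, erase_insert ha]
  congr 1
  refine sum_congr rfl fun i hi => ?_
  have : i ≠ a := fun h => ha (h ▸ hi)
  rw [erase_insert_of_ne (Ne.symm this), prod_insert (fun h => ha (mem_of_mem_erase h)), div_div]

lemma lsum_zero {F : Type} [Field F] (s : Finset F) (P : Polynomial F)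
    (hP : P.natDegree + 1 < #s) :
    ∑ i ∈ s, P.eval i / ∏ j ∈ s.erase i, (i - j) = 0 := by
  have h := Lagrange.coeff_eq_sum (s := s) (v := id) (P := P) (Set.injOn_id _)
    (lt_of_le_of_lt Polynomial.degree_le_natDegree (by exact_mod_cast (by omega)))
  rw [Polynomial.coeff_eq_zero_of_natDegree_lt (by omega)] at h
  simpa using h.symm

lemma lagF {F : Type} [Field F] (h2 : (2 : F) ≠ 0) (A : Finset F) (h0 : (0:F) ∉ A) (h1 : (1:F) ∉ A)
    (hm : (-1 : F) ∉ A) :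
    (∑ i ∈ A, ∏ l ∈ A.erase i, ((1 - l * i) / (i - l)) = (1 - (-1) ^ #A) / 2) ∧
    (∑ i ∈ A, (∏ l ∈ A.erase i, ((1 - l * i) / (i - l))) / i =
      (1 + (-1) ^ #A) / 2 - (-1) ^ #A / ∏ i ∈ A, i) := by
  have hne : (1 : F) ≠ -1 := fun h => h2 (by linear_combination h)
  let f : Polynomial F := ∏ l ∈ A, (1 - Polynomial.C l * Polynomial.X)
  have hf : ∀ t, f.eval t = ∏ l ∈ A, (1 - l * t) := fun t => by
    simp [f, Polynomial.eval_prod]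
  have hd : f.natDegree ≤ #A := by
    refine (Polynomial.natDegree_prod_le _ _).trans ?_
    refine (sum_le_card_nsmul _ _ 1 fun l _ => ?_).trans (by simp)
    compute_degree
  have hm1 : (-1 : F) ∉ A := hm
  have h1' : (1 : F) ∉ insert (-1) A := by simp [h1, hne]
  have h0' : (0 : F) ∉ insert 1 (insert (-1) A) := by simp [h0]
  have e1 := lsum_zero (insert 1 (insert (-1) A)) f (by
    rw [card_insert_of_notMem h1', card_insert_of_notMem hm1]; omega)
  have e0 := lsum_zero (insert 0 (insert 1 (insert (-1) A))) f (by
    rw [card_insert_of_notMem h0', card_insert_of_notMem h1', card_insert_of_notMem hm1]; omega)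
  rw [lsum_insert _ _ h1', prod_insert hm1,
    lsum_insert _ _ hm1 (fun i => f.eval i / (i - 1))] at e1
  rw [lsum_insert _ _ h0', prod_insert h1', prod_insert hm1, 
    lsum_insert _ _ h1' (fun i => f.eval i / (i - 0)), prod_insert hm1,
    lsum_insert _ _ hm1 (fun i => f.eval i / (i - 0) / (i - 1))] at e0
  have p1 : ∏ l ∈ A, (1 - l) ≠ 0 := prod_ne_zero_iff.2 fun l hl h =>
    h1 ((show l = 1 by linear_combination -h) ▸ hl)
  have pm : ∏ l ∈ A, (1 + l) ≠ 0 := prod_ne_zero_iff.2 fun l hl h =>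
    hm ((show l = -1 by linear_combination h) ▸ hl)
  have pp : ∏ l ∈ A, l ≠ 0 := prod_ne_zero_iff.2 fun l hl h => h0 (h ▸ hl)
  have f1 : f.eval 1 = ∏ l ∈ A, (1 - l) := by simp [hf]
  have fm : f.eval (-1) = ∏ l ∈ A, (1 + l) := by simp [hf]
  have f0 : f.eval 0 = 1 := by simp [hf]
  have dm : ∏ j ∈ A, (-1 - j) = (-1) ^ #A * ∏ l ∈ A, (1 + l) := by
    rw [← prod_const, ← prod_mul_distrib]; exact prod_congr rfl fun _ _ => by ring
  have d0 : ∏ j ∈ A, (0 - j) = (-1) ^ #A * ∏ l ∈ A, l := by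
    rw [← prod_const, ← prod_mul_distrib]; exact prod_congr rfl fun _ _ => by ring
  have hs : ((-1 : F) ^ #A) ^ 2 = 1 := by rw [← pow_mul, mul_comm, pow_mul]; simp
  have hs0 : ((-1 : F) ^ #A) ≠ 0 := by simp
  have t1 : ∀ i ∈ A, f.eval i / (i - 1) / (i - -1) / ∏ j ∈ A.erase i, (i - j) =
      - ∏ l ∈ A.erase i, ((1 - l * i) / (i - l)) := fun i hi => by
    have a1 : i - 1 ≠ 0 := fun h => h1 ((show i = 1 by linear_combination h) ▸ hi)
    have a2 : i - -1 ≠ 0 := fun h => hm ((show i = -1 by linear_combination h) ▸ hi)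
    have a3 : ∏ j ∈ A.erase i, (i - j) ≠ 0 := prod_ne_zero_iff.2 fun l hl h =>
      (ne_of_mem_erase hl) (by linear_combination -h)
    rw [hf, ← mul_prod_erase A _ hi, prod_div_distrib]
    field_simp
    ring
  have t0 : ∀ i ∈ A, f.eval i / (i - 0) / (i - 1) / (i - -1) / ∏ j ∈ A.erase i, (i - j) =
      - ((∏ l ∈ A.erase i, ((1 - l * i) / (i - l))) / i) := fun i hi => by
    rw [← neg_div, ← t1 i hi]
    have a0 : i ≠ 0 := fun h => h0 (h ▸ hi)
    rw [sub_zero]; ring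
  rw [sum_congr rfl t1, sum_neg_distrib, f1, fm, dm] at e1
  rw [sum_congr rfl t0, sum_neg_distrib, f0, f1, fm, dm, d0] at e0
  generalize (-1 : F) ^ #A = s at *
  have hsi : s⁻¹ = s := by field_simp; exact hs.symm
  constructor
  · have : (1 - s) / 2 = (∏ l ∈ A, (1 - l)) / ((1 - -1) * ∏ j ∈ A, (1 - j)) + 
      (∏ l ∈ A, (1 + l)) / (-1 - 1) / (s * ∏ l ∈ A, (1 + l)) := by
      have : (1 : F) - -1 = 2 := by ring
      rw [this]
      have : (-1 : F) - 1 = -2 := by ring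
      rw [this]
      field_simp
      linear_combination -hs
    rw [this]
    linear_combination -e1
  · have : (1 + s) / 2 - s / ∏ i ∈ A, i = 1 / ((0 - 1) * ((0 - -1) * (s * ∏ l ∈ A, l))) + 
      ((∏ l ∈ A, (1 - l)) / (1 - 0) / ((1 - -1) * ∏ j ∈ A, (1 - j)) + 
      (∏ l ∈ A, (1 + l)) / (-1 - 0) / (-1 - 1) / (s * ∏ l ∈ A, (1 + l))) := by
      have : (1 : F) - -1 = 2 := by ring
      rw [this]
      have : (-1 : F) - 1 = -2 := by ring
      rw [this]
      have : (0 : F) - -1 = 1 := by ring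
      rw [this]
      have : (-1 : F) - 0 = -1 := by ring
      rw [this]
      simp only [sub_zero, zero_sub]
      field_simp
      linear_combination (∏ i ∈ A, i - 2) * hs
    rw [this]
    linear_combination -e0

/-- index version -/
lemma lagI {F ι : Type} [Field F] [DecidableEq ι] (h2 : (2 : F) ≠ 0) (A : Finset ι) (y : ι → F)
    (hi : Set.InjOn y A) (h0 : ∀ i ∈ A, y i ≠ 0) (h1 : ∀ i ∈ A, y i * y i ≠ 1) :
    (∑ i ∈ A, y i * ∏ l ∈ A.erase i, ((1 - y l * y i) / (1 - y i / y l)) =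
      (1 - (-1) ^ #A) / 2 * ∏ i ∈ A, y i) ∧
    (∑ i ∈ A, ∏ l ∈ A.erase i, ((1 - y l * y i) / (1 - y i / y l)) =
      1 - (1 + (-1) ^ #A) / 2 * ∏ i ∈ A, y i) := by
  obtain ⟨e1, e0⟩ := lagF h2 (A.image y) (by simpa using h0)
    (by simp only [mem_image, not_exists, not_and]; intro i hi h; exact h1 i hi (by rw [h]; ring))
    (by simp only [mem_image, not_exists, not_and]; intro i hi h; exact h1 i hi (by rw [h]; ring))
  have er : ∀ i ∈ A, (A.image y).erase (y i) = (A.erase i).image y := fun i hA => by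
    ext t; simp only [mem_erase, mem_image]
    constructor
    · rintro ⟨h, j, hj, rfl⟩; exact ⟨j, ⟨fun h' => h (by rw [h']), hj⟩, rfl⟩
    · rintro ⟨j, ⟨h, hj⟩, rfl⟩; exact ⟨fun h' => h (hi hj hA h'), j, hj, rfl⟩
  have pr : ∀ i ∈ A, ∏ l ∈ (A.image y).erase (y i), ((1 - l * y i) / (y i - l)) =
      ∏ l ∈ A.erase i, ((1 - y l * y i) / (y i - y l)) := fun i hA => by
    rw [er i hA, prod_image (fun a ha b hb => hi (mem_of_mem_erase ha) (mem_of_mem_erase hb))]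
  rw [card_image_of_injOn hi, sum_image hi, sum_congr rfl pr] at e1
  rw [card_image_of_injOn hi, sum_image hi, prod_image hi,
    sum_congr rfl fun i hA => by rw [pr i hA]] at e0
  have key : ∀ i ∈ A, ∏ l ∈ A.erase i, ((1 - y l * y i) / (1 - y i / y l)) =
      - (-1) ^ #A * (∏ l ∈ A, y l) / y i * ∏ l ∈ A.erase i, ((1 - y l * y i) / (y i - y l)) :=
    fun i hA => by
    have : ∏ l ∈ A.erase i, ((1 - y l * y i) / (1 - y i / y l)) = ∏ l ∈ A.erase i, ((-1) * y l * ((1 - y l * y i) / (y i - y l))) := by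
      refine prod_congr rfl fun l hl => ?_
      have a0 := h0 l (mem_of_mem_erase hl)
      have a1 : y i - y l ≠ 0 := sub_ne_zero.2 fun h =>
        (ne_of_mem_erase hl) (hi (mem_of_mem_erase hl) hA h.symm)
      have a2 : y l - y i ≠ 0 := fun h => a1 (by linear_combination -h)
      have : 1 - y i / y l = -(y i - y l) / y l := by field_simp; ring
      rw [this, div_div_eq_mul_div, div_neg]; field_simp
    rw [this, prod_mul_distrib, prod_mul_distrib, prod_const, ← mul_prod_erase A y hA, card_erase_of_mem hA]
    have hc : 0 < #A := card_pos.2 ⟨i, hA⟩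
    have : (-1 : F) ^ #A = (-1) ^ (#A - 1) * (-1) := by rw [← pow_succ]; congr 1; omega
    rw [this]
    have := h0 i hA
    generalize ∏ l ∈ A.erase i, ((1 - y l * y i) / (y i - y l)) = Q
    field_simp
  have pp : ∏ l ∈ A, y l ≠ 0 := prod_ne_zero_iff.2 h0
  have hs : ((-1 : F) ^ #A) ^ 2 = 1 := by rw [← pow_mul, mul_comm, pow_mul]; simp
  constructor
  · have : ∀ i ∈ A, y i * ∏ l ∈ A.erase i, ((1 - y l * y i) / (1 - y i / y l)) = - (-1) ^ #A * (∏ l ∈ A, y l) * ∏ l ∈ A.erase i, ((1 - y l * y i) / (y i - y l)) := fun i hA => by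
      rw [key i hA]; have := h0 i hA; field_simp
    rw [sum_congr rfl this, ← mul_sum, e1]
    generalize (-1 : F) ^ #A = s at *
    field_simp
    linear_combination hs
  · have : ∀ i ∈ A, ∏ l ∈ A.erase i, ((1 - y l * y i) / (1 - y i / y l)) = - (-1) ^ #A * (∏ l ∈ A, y l) * ((∏ l ∈ A.erase i, ((1 - y l * y i) / (y i - y l))) / y i) := fun i hA => by
      rw [key i hA]; ring
    rw [sum_congr rfl this, ← mul_sum, e0]
    generalize (-1 : F) ^ #A = s at *
    field_simp
    linear_combination (2 - ∏ i ∈ A, y i) * hs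

structure Gen {F ι : Type} [Field F] (x : ι → F) : Prop where
  ne0 : ∀ i, x i ≠ 0
  inj : Function.Injective x
  mul1 : ∀ i j, x i * x j ≠ 1

def yS {F ι : Type} [Field F] (x : ι → F) (S : Finset ι) (i : ι) : F :=
  if i ∈ S then (x i)⁻¹ else x i

def PP {F ι : Type} [Field F] [LinearOrder ι] (y : ι → F) (I : Finset ι) : F :=
  ∏ i ∈ I, ∏ l ∈ I, if i < l then 1 - y i * y l else 1

def WW {F ι : Type} [Field F] [LinearOrder ι] (y : ι → F) (I : Finset ι) (k : ι) : F :=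
  (∏ i ∈ I.erase k, y k / (y k - y i)) / PP y I

def GG {F ι : Type} [Field F] [LinearOrder ι] (x : ι → F) (I : Finset ι) (a b : ℤ) : F :=
  ∑ S ∈ I.powerset with Even #S, ∑ k ∈ I, (∏ i ∈ S, x i) ^ (a + b) * (yS x S k) ^ a * WW (yS x S) I k

def toggle {ι : Type} [DecidableEq ι] (k : ι) (S : Finset ι) : Finset ι := if k ∈ S then S.erase k else insert k S

section
variable {F ι : Type} [Field F] [LinearOrder ι]

lemma mem_toggle (k i : ι) (S : Finset ι) : i ∈ toggle k S ↔ (if i = k then k ∉ S else i ∈ S) := by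
  unfold toggle
  split_ifs <;> simp_all

lemma toggle_toggle (k : ι) (S : Finset ι) : toggle k (toggle k S) = S := by
  ext i; simp only [mem_toggle]; split_ifs <;> simp_all

lemma even_toggle (k : ι) (S : Finset ι) : Even #(toggle k S) ↔ ¬ Even #S := by
  unfold toggle
  split_ifs with h
  · have := card_erase_add_one h
    rw [← this]; simp [Nat.even_add_one]
  · rw [card_insert_of_notMem h]; simp [Nat.even_add_one]

lemma prod_toggle (x : ι → F) (hx : ∀ i, x i ≠ 0) (k : ι) (S : Finset ι) :
    ∏ i ∈ toggle k S, x i = (∏ i ∈ S, x i) * yS x S k := by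
  unfold toggle yS
  split_ifs with h
  · rw [← mul_prod_erase S x h]; have := hx k; field_simp
  · rw [prod_insert h, mul_comm]

lemma Gen.yS {x : ι → F} (h : Gen x) (S : Finset ι) : Gen (yS x S) := by
  have key : ∀ i j, i ≠ j → x i ≠ x j := fun i j hij h' => hij (h.inj h')
  have n0 := h.ne0
  refine ⟨fun i => ?_, fun i j hij => ?_, fun i j => ?_⟩
  · unfold _root_.yS; split_ifs
    · exact inv_ne_zero (h.ne0 i)
    · exact h.ne0 i
  · unfold _root_.yS at hij
    have a := n0 i
    have b := n0 j
    have m := h.mul1 i j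
    split_ifs at hij
    · exact h.inj (inv_injective hij)
    · exfalso; apply m; rw [← hij]; field_simp
    · exfalso; apply m; rw [hij]; field_simp
    · exact h.inj hij
  · unfold _root_.yS
    have a := n0 i
    have b := n0 j
    have m := h.mul1 i j
    split_ifs with h1 h2 h2
    · intro h'; apply m; field_simp at h'; exact h'.symm
    · intro h'
      have : x j = x i := by field_simp at h'; exact h'
      have := h.inj this
      subst this; exact h2 h1
    · intro h'
      have : x i = x j := by field_simp at h'; exact h'
      have := h.inj this
      subst this; exact h1 h2
    · exact m

lemma PP_erase (y : ι → F) (I : Finset ι) (k : ι) (hk : k ∈ I) :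
    PP y I = (∏ i ∈ I.erase k, (1 - y i * y k)) * PP y (I.erase k) := by
  obtain ⟨J, hJ, rfl⟩ : ∃ J, k ∉ J ∧ I = insert k J :=
    ⟨I.erase k, notMem_erase _ _, (insert_erase hk).symm⟩
  rw [erase_insert hJ]
  unfold PP
  simp_rw [prod_insert hJ]
  rw [prod_mul_distrib, ← mul_assoc]
  congr 1
  rw [if_neg (lt_irrefl k), one_mul, ← prod_mul_distrib]
  refine prod_congr rfl fun i hi => ?_
  have : i ≠ k := fun h => hJ (h ▸ hi)
  rcases lt_or_gt_of_ne this with h | h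
  · rw [if_neg (not_lt_of_gt h), if_pos h, one_mul]
  · rw [if_neg (not_lt_of_gt h), if_pos h, mul_one, mul_comm]

lemma PP_congr {y z : ι → F} {I : Finset ι} (h : ∀ i ∈ I, y i = z i) : PP y I = PP z I := by
  unfold PP
  refine prod_congr rfl fun i hi => prod_congr rfl fun j hj => ?_
  rw [h i hi, h j hj]

lemma WW_congr {y z : ι → F} {I : Finset ι} (h : ∀ i ∈ I, y i = z i) (k : ι) (hk : k ∈ I) :
    WW y I k = WW z I k := by
  unfold WW
  rw [PP_congr h]
  congr 1
  refine prod_congr rfl fun i hi => ?_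
  rw [h k hk, h i (mem_of_mem_erase hi)]

lemma PP_ne {y : ι → F} (h : Gen y) (I : Finset ι) : PP y I ≠ 0 := by
  unfold PP
  refine prod_ne_zero_iff.2 fun i _ => prod_ne_zero_iff.2 fun j _ => ?_
  split_ifs
  · exact sub_ne_zero.2 (h.mul1 i j).symm
  · exact one_ne_zero

lemma WW_inv {y z : ι → F} (hy : Gen y) (I : Finset ι) (k : ι) (hk : k ∈ I) (h1 : z k = (y k)⁻¹)
    (h2 : ∀ i ∈ I, i ≠ k → z i = y i) : WW z I k = WW y I k := by
  unfold WW
  rw [PP_erase y I k hk, PP_erase z I k hk, PP_congr (y := z) (z := y)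
    (fun i hi => h2 i (mem_of_mem_erase hi) (ne_of_mem_erase hi)), ← div_div, ← div_div,
    ← prod_div_distrib, ← prod_div_distrib]
  congr 1
  refine prod_congr rfl fun i hi => ?_
  rw [h1, h2 i (mem_of_mem_erase hi) (ne_of_mem_erase hi)]
  have a := hy.ne0 k
  have b : y k - y i ≠ 0 := sub_ne_zero.2 fun h => ne_of_mem_erase hi (hy.inj h).symm
  have c : 1 - y i * y k ≠ 0 := sub_ne_zero.2 (hy.mul1 _ _).symm
  have e1 : (y k)⁻¹ - y i = (1 - y i * y k) / y k := by field_simp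
  have e2 : 1 - y i * (y k)⁻¹ = (y k - y i) / y k := by field_simp
  rw [e1, e2]
  field_simp

lemma term_eq {x : ι → F} (hx : Gen x) (I S : Finset ι) (hS : S ⊆ I) (j k : ι) (hj : j ∈ S) (hk : k ∈ I)
    (hjk : j ≠ k) :
    (∏ i ∈ I.erase j, x j / (x j - x i)) * WW (yS x S) (I.erase j) k =
    WW (yS x S) I k * ((1 - yS x S j / yS x S k) *
      ∏ i ∈ S.erase j, ((1 - yS x S i * yS x S j) / (1 - yS x S j / yS x S i))) := by
  have hy := hx.yS S
  have hjI := hS hj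
  have key : ∏ i ∈ S.erase j, ((1 - yS x S i * yS x S j) / (1 - yS x S j / yS x S i)) =
      ∏ i ∈ I.erase j, (x j / (x j - x i) * (1 - yS x S i * yS x S j)) := by
    rw [← prod_subset (erase_subset_erase j hS)]
    · refine prod_congr rfl fun i hi => ?_
      have hiS := mem_of_mem_erase hi
      rw [div_eq_mul_inv, mul_comm]
      congr 1
      unfold yS; rw [if_pos hiS, if_pos hj]
      have a := hx.ne0 i
      have b := hx.ne0 j
      have c : x j - x i ≠ 0 := sub_ne_zero.2 fun h => ne_of_mem_erase hi (hx.inj h).symm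
      have : 1 - (x j)⁻¹ / (x i)⁻¹ = (x j - x i) / x j := by field_simp
      rw [this, inv_div]
    · intro i hi hi'
      have hij := ne_of_mem_erase hi
      have hiS : i ∉ S := fun h => hi' (mem_erase.2 ⟨hij, h⟩)
      unfold yS; rw [if_neg hiS, if_pos hj]
      have b := hx.ne0 j
      have c : x j - x i ≠ 0 := sub_ne_zero.2 fun h => hij (hx.inj h).symm
      field_simp
  rw [key, prod_mul_distrib]
  unfold WW
  have hk' : k ∈ I.erase j := mem_erase.2 ⟨hjk.symm, hk⟩
  have hj' : j ∈ I.erase k := mem_erase.2 ⟨hjk, hjI⟩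
  rw [PP_erase _ I j hjI, ← mul_prod_erase (I.erase k) _ hj', erase_right_comm]
  have d1 : ∏ i ∈ I.erase j, (1 - yS x S i * yS x S j) ≠ 0 :=
    prod_ne_zero_iff.2 fun i _ => sub_ne_zero.2 (hy.mul1 _ _).symm
  have d2 := PP_ne hy (I.erase j)
  have d3 : yS x S k - yS x S j ≠ 0 := sub_ne_zero.2 fun h => hjk (hy.inj h).symm
  have d4 := hy.ne0 k
  generalize ∏ i ∈ I.erase j, x j / (x j - x i) = E
  generalize ∏ i ∈ (I.erase j).erase k, yS x S k / (yS x S k - yS x S i) = E'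
  generalize ∏ i ∈ I.erase j, (1 - yS x S i * yS x S j) = E'' at *
  field_simp

lemma row_sum (h2 : (2 : F) ≠ 0) {x : ι → F} (hx : Gen x) (I S : Finset ι) (hS : S ⊆ I) (he : Even #S)
    (k : ι) (hk : k ∈ I) :
    (1 - (∏ i ∈ S, x i)⁻¹) * WW (yS x S) I k =
      ∑ j ∈ S.erase k, (∏ i ∈ I.erase j, x j / (x j - x i)) * WW (yS x S) (I.erase j) k := by
  have hy := hx.yS S
  rw [sum_congr rfl fun j hj => term_eq hx I S hS j k (mem_of_mem_erase hj) hk (ne_of_mem_erase hj),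
    ← mul_sum, mul_comm]
  congr 1
  rw [sum_erase _ (by rw [div_self (hy.ne0 k)]; simp)]
  obtain ⟨e1, e2⟩ := lagI h2 S (yS x S) hy.inj.injOn (fun i _ => hy.ne0 i) (fun i _ => hy.mul1 i i)
  have hpr : ∏ i ∈ S, yS x S i = (∏ i ∈ S, x i)⁻¹ := by
    rw [← prod_inv_distrib]; exact prod_congr rfl fun i hi => by simp [yS, hi]
  rw [he.neg_one_pow] at e1 e2
  simp only [sub_mul, one_mul, sum_sub_distrib]
  rw [e2, hpr]
  have : ∑ j ∈ S, yS x S j / yS x S k *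
      ∏ i ∈ S.erase j, ((1 - yS x S i * yS x S j) / (1 - yS x S j / yS x S i)) = 0 := by
    have : ∀ j ∈ S, yS x S j / yS x S k *
      ∏ i ∈ S.erase j, ((1 - yS x S i * yS x S j) / (1 - yS x S j / yS x S i)) = (yS x S k)⁻¹ * (yS x S j *
      ∏ i ∈ S.erase j, ((1 - yS x S i * yS x S j) / (1 - yS x S j / yS x S i))) := fun j _ => by ring
    rw [sum_congr rfl this, ← mul_sum, e1]; simp
  rw [this]
  have : (1 + 1 : F) / 2 = 1 := by field_simp; norm_num
  rw [this]; ring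
end

section
variable {F ι : Type} [Field F] [LinearOrder ι]

lemma yS_iff (x : ι → F) (i : ι) {S T : Finset ι} (h : i ∈ S ↔ i ∈ T) : yS x S i = yS x T i := by
  unfold yS; by_cases h' : i ∈ T <;> simp [h', h]

lemma yS_toggle (x : ι → F) (k : ι) (S : Finset ι) : yS x (toggle k S) k = (yS x S k)⁻¹ := by
  unfold yS; simp only [mem_toggle]; split_ifs <;> simp_all

lemma yS_toggle_ne (x : ι → F) (k i : ι) (hi : i ≠ k) (S : Finset ι) :
    yS x (toggle k S) i = yS x S i := by
  refine yS_iff x i ?_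
  simp only [mem_toggle, if_neg hi]

lemma toggle_subset {k : ι} {S I : Finset ι} (hk : k ∈ I) (hS : S ⊆ I) : toggle k S ⊆ I := by
  intro i hi; rw [mem_toggle] at hi
  split_ifs at hi with h
  · exact h ▸ hk
  · exact hS hi

lemma GG_diff (h2 : (2 : F) ≠ 0) {x : ι → F} (hx : Gen x) (I : Finset ι) (a b : ℤ) :
    GG x I a b - GG x I a (b - 1) = ∑ j ∈ I, x j ^ (a + b) * (∏ i ∈ I.erase j, x j / (x j - x i)) *
      GG x (I.erase j) b a := by
  have L : GG x I a b - GG x I a (b - 1) = ∑ S ∈ I.powerset with Even #S, ∑ k ∈ I, ∑ j ∈ S.erase k,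
      (∏ i ∈ S, x i) ^ (a + b) * (yS x S k) ^ a *
      ((∏ i ∈ I.erase j, x j / (x j - x i)) * WW (yS x S) (I.erase j) k) := by
    unfold GG
    rw [← sum_sub_distrib]
    refine sum_congr rfl fun S hS => ?_
    rw [← sum_sub_distrib]
    refine sum_congr rfl fun k hk => ?_
    simp only [mem_filter, mem_powerset] at hS
    rw [← mul_sum, ← row_sum h2 hx I S hS.1 hS.2 k hk]
    have : ∏ i ∈ S, x i ≠ 0 := prod_ne_zero_iff.2 fun i _ => hx.ne0 i
    rw [show a + (b - 1) = (a + b) - 1 by ring, zpow_sub₀ this, zpow_one]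
    ring
  have L2 : ∀ S ∈ I.powerset.filter (fun S => Even #S), ∑ k ∈ I, ∑ j ∈ S.erase k,
      (∏ i ∈ S, x i) ^ (a + b) * (yS x S k) ^ a *
      ((∏ i ∈ I.erase j, x j / (x j - x i)) * WW (yS x S) (I.erase j) k) =
      ∑ j ∈ I, ∑ k ∈ I.erase j, if j ∈ S then (∏ i ∈ S, x i) ^ (a + b) * (yS x S k) ^ a *
      ((∏ i ∈ I.erase j, x j / (x j - x i)) * WW (yS x S) (I.erase j) k) else 0 := by
    intro S hS
    simp only [mem_filter, mem_powerset] at hS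
    refine (sum_comm' (t' := I) (s' := fun j => if j ∈ S then I.erase j else ∅) ?_).trans ?_
    · intro k j
      by_cases h : j ∈ S
      · simp only [h, if_true, mem_erase]
        have := hS.1 h
        tauto
      · simp [h]
    · refine sum_congr rfl fun j _ => ?_
      split_ifs <;> simp
  rw [L, sum_congr rfl L2, sum_comm]
  refine sum_congr rfl fun j hj => ?_
  unfold GG
  rw [sum_comm, sum_comm (s := (I.erase j).powerset.filter _), mul_sum]
  refine sum_congr rfl fun k hk => ?_
  have hkj := ne_of_mem_erase hk
  have hkI := mem_of_mem_erase hk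
  rw [← sum_filter, mul_sum]
  refine sum_nbij' (fun S => (toggle k S).erase j) (fun S => toggle k (insert j S)) ?_ ?_ ?_ ?_ ?_
  · intro S hS
    simp only [mem_filter, mem_powerset] at hS ⊢
    refine ⟨erase_subset_erase j (toggle_subset hkI hS.1.1), ?_⟩
    have hm : j ∈ toggle k S := by rw [mem_toggle, if_neg hkj.symm]; exact hS.2
    have h1 := card_erase_add_one hm
    have h2 := (even_toggle k S).not.2 (not_not.2 hS.1.2)
    rw [← h1, Nat.even_add_one, not_not] at h2
    exact h2
  · intro S hS
    simp only [mem_filter, mem_powerset] at hS ⊢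
    have hjS : j ∉ S := fun h => (mem_erase.1 (hS.1 h)).1 rfl
    refine ⟨⟨toggle_subset hkI (insert_subset hj (hS.1.trans (erase_subset _ _))), ?_⟩, ?_⟩
    · rw [even_toggle, card_insert_of_notMem hjS, Nat.even_add_one, not_not]; exact hS.2
    · rw [mem_toggle, if_neg hkj.symm]; exact mem_insert_self _ _
  · intro S hS
    simp only [mem_filter, mem_powerset] at hS ⊢
    have hm : j ∈ toggle k S := by rw [mem_toggle, if_neg hkj.symm]; exact hS.2
    rw [insert_erase hm, toggle_toggle]
  · intro S hS
    simp only [mem_filter, mem_powerset] at hS ⊢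
    have hjS : j ∉ S := fun h => (mem_erase.1 (hS.1 h)).1 rfl
    rw [toggle_toggle, erase_insert hjS]
  · intro S hS
    simp only [mem_filter, mem_powerset] at hS
    have hm : j ∈ toggle k S := by rw [mem_toggle, if_neg hkj.symm]; exact hS.2
    have e1 : yS x ((toggle k S).erase j) k = (yS x S k)⁻¹ := by
      rw [← yS_toggle]; refine yS_iff x k ?_; simp only [mem_erase, ne_eq, hkj, not_false_eq_true, true_and]
    have e2 : WW (yS x ((toggle k S).erase j)) (I.erase j) k = WW (yS x S) (I.erase j) k := by
      refine WW_inv (hx.yS S) _ _ hk e1 fun i hi hik => ?_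
      rw [← yS_toggle_ne x k i hik S]; refine yS_iff x i ?_
      simp only [mem_erase, ne_eq, ne_of_mem_erase hi, not_false_eq_true, true_and]
    have e3 := prod_toggle x hx.ne0 k S
    rw [← mul_prod_erase _ x hm] at e3
    have e4 : x j ^ (a + b) * (∏ i ∈ (toggle k S).erase j, x i) ^ (a + b) =
        (∏ i ∈ S, x i) ^ (a + b) * yS x S k ^ (a + b) := by
      rw [← mul_zpow, ← mul_zpow, e3]
    have e5 : yS x S k ^ (a + b) * (yS x S k)⁻¹ ^ b = yS x S k ^ a := by
      rw [inv_zpow', ← zpow_add₀ ((hx.yS S).ne0 k)]; congr 1; ring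
    rw [e1, e2, ← e5, add_comm b a]
    linear_combination (-(yS x S k)⁻¹ ^ b * 
      (∏ i ∈ I.erase j, x j / (x j - x i)) * WW (yS x S) (I.erase j) k) * e4

lemma pow_W_zero {z : ι → F} (hz : Gen z) (I : Finset ι) (hI : 2 ≤ #I) :
    ∑ k ∈ I, (z k)⁻¹ * WW z I k = 0 := by
  have h := lsum_zero (I.image z) (Polynomial.X ^ (#I - 2)) (by
    rw [card_image_of_injective _ hz.inj, Polynomial.natDegree_X_pow]; omega)
  rw [sum_image hz.inj.injOn] at h
  have : ∀ k ∈ I, (z k)⁻¹ * WW z I k = (PP z I)⁻¹ * (Polynomial.eval (z k) (Polynomial.X ^ (#I - 2)) / ∏ j ∈ (image z I).erase (z k), (z k - j)) := by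
    intro k hk
    unfold WW
    rw [show (image z I).erase (z k) = image z (I.erase k) from (by
      ext t; simp only [mem_erase, mem_image]
      constructor
      · rintro ⟨h, j, hj, rfl⟩; exact ⟨j, ⟨fun h' => h (by rw [h']), hj⟩, rfl⟩
      · rintro ⟨j, ⟨h, hj⟩, rfl⟩; exact ⟨fun h' => h (hz.inj h'), j, hj, rfl⟩),
      prod_image hz.inj.injOn, prod_div_distrib, prod_const, card_erase_of_mem hk]
    have : z k ^ (#I - 1) = z k * z k ^ (#I - 2) := by rw [← pow_succ']; congr 1; omega
    rw [this]
    have := hz.ne0 k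
    simp only [Polynomial.eval_pow, Polynomial.eval_X]
    field_simp
  rw [sum_congr rfl this, ← mul_sum, h, mul_zero]

lemma GG_bd {x : ι → F} (hx : Gen x) (I : Finset ι) (hI : 2 ≤ #I) (a : ℤ) : GG x I a (-1) = 0 := by
  unfold GG
  have : ∀ k ∈ I, ∑ S ∈ I.powerset with Even #S, 
      (∏ i ∈ S, x i) ^ (a + -1) * (yS x S k) ^ a * WW (yS x S) I k =
      ∑ S ∈ I.powerset with ¬ Even #S, (∏ i ∈ S, x i) ^ (a - 1) * ((yS x S k)⁻¹ * WW (yS x S) I k) := by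
    intro k hk
    refine sum_nbij' (toggle k) (toggle k) ?_ ?_ ?_ ?_ ?_
    · intro S hS
      simp only [mem_filter, mem_powerset] at hS ⊢
      exact ⟨toggle_subset hk hS.1, by rw [even_toggle, not_not]; exact hS.2⟩
    · intro S hS
      simp only [mem_filter, mem_powerset] at hS ⊢
      exact ⟨toggle_subset hk hS.1, by rw [even_toggle]; exact hS.2⟩
    · intro S _; exact toggle_toggle k S
    · intro S _; exact toggle_toggle k S
    · intro S hS
      rw [WW_inv (hx.yS S) I k hk (yS_toggle x k S) (fun i _ hik => yS_toggle_ne x k i hik S),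
        prod_toggle x hx.ne0, yS_toggle, inv_inv, mul_zpow, ← sub_eq_add_neg]
      have : yS x S k ^ a = yS x S k ^ (a - 1) * yS x S k := by
        rw [← zpow_add_one₀ ((hx.yS S).ne0 k)]; congr 1; ring
      rw [this]; ring
  rw [sum_comm, sum_congr rfl this, sum_comm]
  refine sum_eq_zero fun S _ => ?_
  rw [← mul_sum, pow_W_zero (hx.yS S) I hI, mul_zero]

lemma R_eq_GG (h2 : (2 : F) ≠ 0) {x : ι → F} (hx : Gen x) : ∀ (n : ℕ) (I : Finset ι), #I = n + 1 →
    ∀ a b : ℕ, R x (n + 1) I a b = GG x I a b := by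
  intro n
  induction n with
  | zero =>
    intro I hI a b
    obtain ⟨j, rfl⟩ := card_eq_one.1 hI
    have : ({j} : Finset ι).powerset.filter (fun S => Even #S) = {∅} := by
      ext S
      simp only [mem_filter, mem_powerset, subset_singleton_iff, mem_singleton]
      constructor
      · rintro ⟨h | rfl, h'⟩
        · exact h
        · simp at h'
      · rintro rfl; simp
    unfold GG; rw [this]
    simp [R, WW, PP, yS]
  | succ n ih =>
    intro I hI a b
    have key : ∀ b : ℕ, ∑ d ∈ range (b + 1), (GG x I a d - GG x I a ((d : ℤ) - 1)) = GG x I a b := by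
      intro b
      induction b with
      | zero =>
        have := GG_bd hx I (by omega) a
        simp [this]
      | succ b ihb => rw [sum_range_succ, ihb]; push_cast; ring_nf
    rw [← key b, R]
    refine sum_congr rfl fun d _ => ?_
    rw [GG_diff h2 hx]
    refine sum_congr rfl fun j hj => ?_
    rw [ih (I.erase j) (by rw [card_erase_of_mem hj, hI]; omega) d a]
    norm_cast
end

section
variable {F : Type} [Field F]

lemma Vd_eq_vand {m : ℕ} (z : Fin m → F) : Vd z = (Matrix.vandermonde (fun i => z i.rev)).det := by
  rw [Matrix.det_vandermonde]
  unfold Vd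
  have : ∀ i : Fin m, ∏ j ∈ Ioi i, (z j.rev - z i.rev) = ∏ j, if i < j then z j.rev - z i.rev else 1 := by
    intro i
    rw [← prod_filter]
    congr 1
    ext j; simp
  rw [prod_congr rfl fun i _ => this i, ← Equiv.prod_comp Fin.revPerm]
  rw [prod_congr rfl fun i _ => (Equiv.prod_comp Fin.revPerm _).symm]
  rw [prod_comm]
  refine prod_congr rfl fun i _ => prod_congr rfl fun j _ => ?_
  simp only [Fin.revPerm_apply, Fin.rev_lt_rev]

lemma bial_zero {m : ℕ} (z : Fin m → F) : bial z (fun _ => 0) = Vd z := by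
  rw [Vd_eq_vand, ← Matrix.det_transpose, ← Matrix.det_submatrix_equiv_self Fin.revPerm]
  unfold bial
  congr 1
  ext i j
  simp [Matrix.vandermonde, Fin.val_rev]
  congr 1
  omega

lemma prod_erase_succAbove {m : ℕ} (k : Fin (m + 1)) (f : Fin (m + 1) → F) :
    ∏ i ∈ univ.erase k, f i = ∏ i : Fin m, f (k.succAbove i) := by
  have : univ.erase k = univ.map k.succAboveEmb := by
    ext i
    simp only [mem_erase, mem_univ, and_true, mem_map, true_and]
    constructor
    · intro h; exact Fin.exists_succAbove_eq h
    · rintro ⟨j, rfl⟩; exact Fin.succAbove_ne k j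
  rw [this, prod_map]; rfl

lemma sum_WW {m : ℕ} (z : Fin (m + 1) → F) (hz : Gen z) (a : ℕ) :
    (∑ k, z k ^ a * WW z univ k) * (Vd z * PP z univ) = bial z (Fin.cons a (fun _ => 0)) := by
  rw [bial_cons z hz.inj]
  have h := PP_ne hz univ
  unfold WW
  rw [sum_mul, mul_sum]
  refine sum_congr rfl fun k _ => ?_
  have hV : Vd (fun i => z (k.succAbove i)) ≠ 0 :=
    Vd_ne _ (hz.inj.comp Fin.succAbove_right_injective)
  rw [bial_zero, div_self hV, prod_erase_succAbove]
  field_simp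

lemma prod_pairs {m : ℕ} (u : Fin (m + 1) → F) :
    ∏ i, ∏ j, (if i < j then u i * u j else 1) = (∏ i, u i) ^ m := by
  have h1 : ∏ i, ∏ j, (if i < j then u i * u j else 1) =
      (∏ i, ∏ j, if i < j then u i else 1) * ∏ i, ∏ j, if i < j then u j else 1 := by
    simp_rw [← prod_mul_distrib]
    refine prod_congr rfl fun i _ => prod_congr rfl fun j _ => ?_
    split_ifs <;> simp
  rw [h1, prod_comm (f := fun i j => if i < j then u j else 1)]
  simp_rw [← prod_mul_distrib]
  rw [← prod_pow]
  refine prod_congr rfl fun i _ => ?_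
  rw [← mul_prod_erase univ _ (mem_univ i)]
  simp only [lt_irrefl, if_false, mul_one, one_mul]
  rw [prod_congr rfl (g := fun _ => u i), prod_const, card_erase_of_mem (mem_univ i), card_univ, Fintype.card_fin]
  · rfl
  · intro j hj
    rcases lt_or_gt_of_ne (ne_of_mem_erase hj) with h | h
    · rw [if_neg (not_lt_of_gt h), if_pos h, one_mul]
    · rw [if_neg (not_lt_of_gt h), if_pos h, mul_one]

lemma Vd_PP {m : ℕ} {x : Fin (m + 1) → F} (hx : Gen x) (S : Finset (Fin (m + 1))) :
    Vd (yS x S) * PP (yS x S) univ * (∏ i ∈ S, x i) ^ (2 * m) = Vd x * PP x univ := by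
  have e : (∏ i ∈ S, x i) ^ (2 * m) = ∏ i, ∏ j, (if i < j then
      (if i ∈ S then x i ^ 2 else 1) * (if j ∈ S then x j ^ 2 else 1) else 1) := by
    rw [prod_pairs, pow_mul, prod_ite_mem, univ_inter, prod_pow]
  rw [e]
  unfold Vd PP
  simp_rw [← prod_mul_distrib]
  refine prod_congr rfl fun i _ => prod_congr rfl fun j _ => ?_
  by_cases hij : i < j
  · simp only [if_pos hij]
    unfold yS
    have a := hx.ne0 i
    have b := hx.ne0 j
    split_ifs <;> field_simp <;> ring
  · simp [hij]

lemma det_add {m : ℕ} (u v : Fin m → Fin m → F) :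
    Matrix.det (Matrix.of fun i j => u i j + v i j) =
      ∑ S : Finset (Fin m), Matrix.det (Matrix.of fun i j => if j ∈ S then v i j else u i j) := by
  rw [← Matrix.det_transpose]
  have := Matrix.detRowAlternating.map_add_univ (fun j i => v i j) (fun j i => u i j)
  refine Eq.trans ?_ (this.trans ?_)
  · show Matrix.det _ = Matrix.det _
    congr 1
    ext i j; simp [add_comm]
  · refine sum_congr rfl fun S _ => ?_
    rw [← Matrix.det_transpose]
    show Matrix.det _ = Matrix.det _
    congr 1
    ext i j
    simp only [Matrix.transpose_apply, Matrix.of_apply, piecewise]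
    by_cases h : i ∈ S <;> simp [h]

/-- the determinants of type D (plus/minus) -/
def Mdet {m : ℕ} (x : Fin (m + 1) → F) (a b : ℕ) (s : F) : F :=
  Matrix.det (Matrix.of fun i j : Fin (m + 1) =>
    x j ^ ((Fin.cons (a + m) (fun i : Fin m => m - 1 - (i : ℕ)) : Fin (m + 1) → ℕ) i) +
    s * x j ^ ((Fin.cons (b + m) (fun i : Fin m => a + b + m + 1 + (i : ℕ)) : Fin (m + 1) → ℕ) i))

lemma Mdet_eq {m : ℕ} (x : Fin (m + 1) → F) (hx : Gen x) (a b : ℕ) (s : F) :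
    Mdet x a b s = ∑ S : Finset (Fin (m + 1)), s ^ #S * (∏ i ∈ S, x i) ^ (a + b + 2 * m) *
      bial (yS x S) (Fin.cons a (fun _ => 0)) := by
  unfold Mdet
  rw [det_add]
  refine sum_congr rfl fun S _ => ?_
  have : s ^ #S * (∏ i ∈ S, x i) ^ (a + b + 2 * m) =
      ∏ j, if j ∈ S then s * x j ^ (a + b + 2 * m) else 1 := by
    rw [prod_ite_mem, univ_inter, prod_mul_distrib, prod_const, prod_pow]
  rw [this]
  unfold bial
  rw [← Matrix.det_mul_row]
  congr 1
  ext i j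
  simp only [Matrix.of_apply, yS]
  have b := hx.ne0 j
  by_cases h : j ∈ S
  · simp only [h, if_true, inv_pow, mul_assoc]
    congr 1
    rw [eq_mul_inv_iff_mul_eq₀ (pow_ne_zero _ b), ← pow_add]
    congr 1
    refine Fin.cases ?_ (fun i => ?_) i
    · simp; omega
    · simp; omega
  · simp only [h, if_false, one_mul]
    congr 1
    refine Fin.cases ?_ (fun i => ?_) i
    · simp
    · simp; omega

theorem GG_det {m : ℕ} (x : Fin (m + 1) → F) (hx : Gen x) (a b : ℕ) :
    2 * GG x univ a b * (Vd x * PP x univ) = Mdet x a b 1 + Mdet x a b (-1) := by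
  rw [Mdet_eq x hx, Mdet_eq x hx, ← sum_add_distrib]
  unfold GG
  rw [powerset_univ, sum_filter, mul_sum, sum_mul]
  refine sum_congr rfl fun S _ => ?_
  rcases Nat.even_or_odd #S with h | h
  · rw [if_pos h, h.neg_one_pow, one_pow, ← Vd_PP hx S, ← sum_WW _ (hx.yS S)]
    have : ∀ k, (∏ i ∈ S, x i) ^ ((a : ℤ) + b) * yS x S k ^ (a : ℤ) * WW (yS x S) univ k =
      (∏ i ∈ S, x i) ^ (a + b) * (yS x S k ^ a * WW (yS x S) univ k) := fun k => by
      rw [← mul_assoc]; norm_cast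
    rw [sum_congr rfl fun k _ => this k, ← mul_sum, pow_add (∏ i ∈ S, x i) (a + b)]
    ring
  · rw [if_neg (by simpa using h), h.neg_one_pow]
    simp
end

section
variable {F : Type} [Field F]

open Polynomial in
/-- Chebyshev-like polynomials, homogenised with `A * B = D`. -/
def chebU (D : F) : ℕ → Polynomial F
  | 0 => 1
  | 1 => X
  | n + 2 => X * chebU D (n + 1) - C D * chebU D n

lemma chebU_monic (D : F) (n : ℕ) : (chebU D n).natDegree = n ∧ (chebU D n).Monic ∧
    (chebU D (n + 1)).natDegree = n + 1 ∧ (chebU D (n + 1)).Monic := by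
  induction n with
  | zero => simp [chebU, Polynomial.monic_X]
  | succ n ih =>
    obtain ⟨h1, h2, h3, h4⟩ := ih
    refine ⟨h3, h4, ?_⟩
    have hm : (Polynomial.X * chebU D (n + 1)).Monic := Polynomial.monic_X.mul h4
    have hd : (Polynomial.X * chebU D (n + 1)).natDegree = n + 2 := by
      rw [Polynomial.monic_X.natDegree_mul h4, h3, Polynomial.natDegree_X]; ring
    have hlt : (Polynomial.C D * chebU D n).degree < (Polynomial.X * chebU D (n + 1)).degree := by
      rw [Polynomial.degree_eq_natDegree hm.ne_zero, hd]
      refine lt_of_le_of_lt ((Polynomial.degree_mul_le _ _).trans (add_le_add_left Polynomial.degree_C_le _)) ?_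
      rw [zero_add, Polynomial.degree_eq_natDegree h2.ne_zero, h1]
      exact_mod_cast (by omega)
    have e : chebU D (n + 1 + 1) = Polynomial.X * chebU D (n + 1) - Polynomial.C D * chebU D n := by
      rw [chebU]
    rw [e]
    refine ⟨?_, hm.sub_of_left hlt⟩
    rw [Polynomial.natDegree_eq_of_degree_eq (Polynomial.degree_sub_eq_left_of_degree_lt hlt), hd]

lemma chebU_eval (A B : F) (n : ℕ) : (A - B) * (chebU (A * B) n).eval (A + B) = A ^ (n + 1) - B ^ (n + 1) ∧
    (A - B) * (chebU (A * B) (n + 1)).eval (A + B) = A ^ (n + 2) - B ^ (n + 2) := by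
  induction n with
  | zero => simp [chebU]; ring
  | succ n ih =>
    refine ⟨ih.2, ?_⟩
    have e : chebU (A * B) (n + 1 + 1) = Polynomial.X * chebU (A * B) (n + 1) - Polynomial.C (A * B) * chebU (A * B) n := by
      rw [chebU]
    rw [e]
    simp only [Polynomial.eval_sub, Polynomial.eval_mul, Polynomial.eval_X, Polynomial.eval_C]
    linear_combination (A + B) * ih.2 - (A * B) * ih.1

lemma det_minus {n : ℕ} (A B : Fin n → F) (D : F) (h : ∀ i, A i * B i = D) :
    Matrix.det (Matrix.of fun i j : Fin n => A i ^ ((j : ℕ) + 1) - B i ^ ((j : ℕ) + 1)) =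
      (∏ i, (A i - B i)) * (Matrix.vandermonde fun i => A i + B i).det := by
  rw [Matrix.det_eval_matrixOfPolynomials_eq_det_vandermonde _ (fun j : Fin n => chebU D j)
    (fun j => (chebU_monic D j).1) (fun j => (chebU_monic D j).2.1), ← Matrix.det_mul_column]
  congr 1
  ext i j
  simp only [Matrix.of_apply]
  rw [← h i, (chebU_eval (A i) (B i) j).1]

open Polynomial in
def chebT (D : F) : ℕ → Polynomial F
  | 0 => 1
  | 1 => X
  | 2 => X * X - C (2 * D)
  | n + 3 => X * chebT D (n + 2) - C D * chebT D (n + 1)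

lemma chebT_monic (D : F) (n : ℕ) : (chebT D n).natDegree = n ∧ (chebT D n).Monic ∧
    (chebT D (n + 1)).natDegree = n + 1 ∧ (chebT D (n + 1)).Monic := by
  induction n with
  | zero => simp [chebT, Polynomial.monic_X]
  | succ n ih =>
    obtain ⟨h1, h2, h3, h4⟩ := ih
    refine ⟨h3, h4, ?_⟩
    have hm : (Polynomial.X * chebT D (n + 1)).Monic := Polynomial.monic_X.mul h4
    have hd : (Polynomial.X * chebT D (n + 1)).natDegree = n + 2 := by
      rw [Polynomial.monic_X.natDegree_mul h4, h3, Polynomial.natDegree_X]; ring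
    obtain ⟨E, e⟩ : ∃ E : F, chebT D (n + 1 + 1) = Polynomial.X * chebT D (n + 1) - Polynomial.C E * chebT D n := by
      cases n with
      | zero => exact ⟨2 * D, by simp [chebT]⟩
      | succ n => exact ⟨D, by rw [chebT]⟩
    have hlt : (Polynomial.C E * chebT D n).degree < (Polynomial.X * chebT D (n + 1)).degree := by
      rw [Polynomial.degree_eq_natDegree hm.ne_zero, hd]
      refine lt_of_le_of_lt ((Polynomial.degree_mul_le _ _).trans (add_le_add_left Polynomial.degree_C_le _)) ?_
      rw [zero_add, Polynomial.degree_eq_natDegree h2.ne_zero, h1]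
      exact_mod_cast (by omega)
    rw [e]
    refine ⟨?_, hm.sub_of_left hlt⟩
    rw [Polynomial.natDegree_eq_of_degree_eq (Polynomial.degree_sub_eq_left_of_degree_lt hlt), hd]

lemma chebT_eval (A B : F) (n : ℕ) : (chebT (A * B) (n + 1)).eval (A + B) = A ^ (n + 1) + B ^ (n + 1) ∧
    (chebT (A * B) (n + 2)).eval (A + B) = A ^ (n + 2) + B ^ (n + 2) := by
  induction n with
  | zero => simp [chebT]; ring
  | succ n ih =>
    refine ⟨ih.2, ?_⟩
    have e : chebT (A * B) (n + 1 + 2) = Polynomial.X * chebT (A * B) (n + 2) - Polynomial.C (A * B) * chebT (A * B) (n + 1) := by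
      rw [chebT]
    rw [e]
    simp only [Polynomial.eval_sub, Polynomial.eval_mul, Polynomial.eval_X, Polynomial.eval_C]
    linear_combination (A + B) * ih.2 - (A * B) * ih.1

/-- antidiagonal coefficients -/
def Cc (g : ℕ → F) (D : F) (n d : ℕ) : F :=
  ∑ k ∈ range (n + 1), ∑ l ∈ range (n + 1), if l = k + d then g k * g l * (D ^ l)⁻¹ else 0

lemma Cc_rel (g : ℕ → F) (D A B : F) (hD : D ≠ 0) (h : A * B = D) (n : ℕ)
    (hg : ∑ k ∈ range (n + 1), g k * (B⁻¹) ^ k = 0) :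
    ∑ k ∈ range (n + 1), g k ^ 2 * (D ^ k)⁻¹ +
      ∑ d ∈ range n, Cc g D n (d + 1) * (A ^ (d + 1) + B ^ (d + 1)) = 0 := by
  have hA : A ≠ 0 := fun h' => hD (by rw [← h, h']; ring)
  have hB : B ≠ 0 := fun h' => hD (by rw [← h, h']; ring)
  have e0 : ∑ k ∈ range (n + 1), ∑ l ∈ range (n + 1), g k * g l * (A⁻¹ ^ l * B⁻¹ ^ k) = 0 := by
    have : (∑ k ∈ range (n + 1), g k * (B⁻¹) ^ k) * ∑ k ∈ range (n + 1), g k * (A⁻¹) ^ k = 0 := by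
      rw [hg, zero_mul]
    rw [sum_mul_sum] at this
    rw [← this]
    refine sum_congr rfl fun k _ => sum_congr rfl fun l _ => by ring
  have e1 : ∑ d ∈ range n, Cc g D n (d + 1) * (A ^ (d + 1) + B ^ (d + 1)) =
      ∑ k ∈ range (n + 1), ∑ l ∈ range (n + 1), if k < l then
        g k * g l * (D ^ l)⁻¹ * (A ^ (l - k) + B ^ (l - k)) else 0 := by
    unfold Cc
    simp_rw [sum_mul]
    rw [sum_comm]
    refine sum_congr rfl fun k _ => ?_
    rw [sum_comm]
    refine sum_congr rfl fun l hl => ?_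
    rw [mem_range] at hl
    split_ifs with hkl
    · rw [sum_eq_single (l - k - 1)]
      · rw [if_pos (by omega)]
        have : l - k - 1 + 1 = l - k := by omega
        rw [this]
      · intro d _ hd
        rw [if_neg (by omega), zero_mul]
      · intro h'; exfalso; apply h'; rw [mem_range]; omega
    · refine sum_eq_zero fun d _ => ?_
      rw [if_neg (by omega), zero_mul]
  have e2 : ∑ k ∈ range (n + 1), g k ^ 2 * (D ^ k)⁻¹ = ∑ k ∈ range (n + 1), ∑ l ∈ range (n + 1),
      if k = l then g k * g l * (A⁻¹ ^ l * B⁻¹ ^ k) else 0 := by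
    refine sum_congr rfl fun k hk => ?_
    rw [sum_ite_eq, if_pos hk, ← mul_pow, ← mul_inv, h, inv_pow]; ring
  have e3 : ∑ k ∈ range (n + 1), ∑ l ∈ range (n + 1), (if k < l then
        g k * g l * (D ^ l)⁻¹ * (A ^ (l - k) + B ^ (l - k)) else 0) =
      ∑ k ∈ range (n + 1), ∑ l ∈ range (n + 1), (if k < l then g k * g l * (A⁻¹ ^ l * B⁻¹ ^ k) else 0) + 
      ∑ k ∈ range (n + 1), ∑ l ∈ range (n + 1), (if l < k then g k * g l * (A⁻¹ ^ l * B⁻¹ ^ k) else 0) := by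
    rw [sum_comm (f := fun k l => if l < k then g k * g l * (A⁻¹ ^ l * B⁻¹ ^ k) else 0)]
    simp_rw [← sum_add_distrib]
    refine sum_congr rfl fun k _ => sum_congr rfl fun l _ => ?_
    split_ifs with hkl
    · obtain ⟨d, rfl⟩ := Nat.exists_eq_add_of_le hkl.le
      rw [Nat.add_sub_cancel_left, ← h]
      simp only [pow_add, mul_pow, inv_pow]
      field_simp
      ring
    · simp
  refine Eq.trans ?_ e0
  rw [e1, e2, e3, ← sum_add_distrib, ← sum_add_distrib]
  refine sum_congr rfl fun k _ => ?_
  rw [← sum_add_distrib, ← sum_add_distrib]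
  refine sum_congr rfl fun l _ => ?_
  rcases lt_trichotomy k l with hh | hh | hh
  · simp [hh, hh.ne, not_lt_of_gt hh]
  · simp [hh]
  · simp [hh, hh.ne', not_lt_of_gt hh]

lemma Cc_top (g : ℕ → F) (D : F) (n : ℕ) : Cc g D n n = g 0 * g n * (D ^ n)⁻¹ := by
  unfold Cc
  rw [sum_eq_single 0, sum_eq_single n]
  · simp
  · intro l _ hl; rw [if_neg (by omega)]
  · intro h; simp at h
  · intro k hk hk0
    refine sum_eq_zero fun l hl => ?_
    rw [mem_range] at hl
    rw [if_neg (by omega)]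
  · intro h; simp at h

lemma det_plus {m : ℕ} (A B : Fin (m + 1) → F) (D : F) (hD : D ≠ 0) (h : ∀ i, A i * B i = D) (g : ℕ → F)
    (hg : ∀ t, ∑ k ∈ range (m + 2), g k * t ^ k = ∏ i, (1 - B i * t)) (hg0 : g 0 = 1)
    (hgn : g (m + 1) = (-1) ^ (m + 1) * ∏ i, B i) :
    Matrix.det (Matrix.of fun i j : Fin (m + 1) => A i ^ ((j : ℕ) + 1) + B i ^ ((j : ℕ) + 1)) =
      (∏ i, A i) * (∑ k ∈ range (m + 2), g k ^ 2 * (D ^ k)⁻¹) *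
        (Matrix.vandermonde fun i => A i + B i).det := by
  have hA : ∀ i, A i ≠ 0 := fun i h' => hD (by rw [← h i, h']; ring)
  have hB : ∀ i, B i ≠ 0 := fun i h' => hD (by rw [← h i, h']; ring)
  set Sm := ∑ k ∈ range (m + 2), g k ^ 2 * (D ^ k)⁻¹ with hSm
  have hrel : ∀ i, Sm + ∑ d ∈ range (m + 1), Cc g D (m + 1) (d + 1) * (A i ^ (d + 1) + B i ^ (d + 1)) = 0 := by
    intro i
    refine Cc_rel g D (A i) (B i) hD (h i) (m + 1) ?_
    rw [hg]
    exact prod_eq_zero (mem_univ i) (by rw [mul_inv_cancel₀ (hB i)]; ring)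
  set Ct := Cc g D (m + 1) (m + 1) with hCt
  have hC1 : Ct * ∏ i, A i = (-1) ^ (m + 1) := by
    rw [hCt, Cc_top, hg0, hgn]
    have : (∏ i, A i) * ∏ i, B i = D ^ (m + 1) := by
      rw [← prod_mul_distrib, prod_congr rfl fun i _ => h i]; simp
    have hp := pow_ne_zero (m + 1) hD
    field_simp
    rw [mul_comm (∏ i, B i), this]
  have hC0 : Ct ≠ 0 := fun h' => by rw [h', zero_mul] at hC1; exact pow_ne_zero (m + 1) (by simp) hC1.symm
  let V' : Matrix (Fin (m + 1)) (Fin (m + 1)) F := Matrix.of fun i j => (chebT D j).eval (A i + B i)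
  have hV' : V'.det = (Matrix.vandermonde fun i => A i + B i).det :=
    (Matrix.det_eval_matrixOfPolynomials_eq_det_vandermonde _ (fun j : Fin (m + 1) => chebT D j)
    (fun j => (chebT_monic D j).1) (fun j => (chebT_monic D j).2.1)).symm
  have hT : ∀ i (k : ℕ), (chebT D (k + 1)).eval (A i + B i) = A i ^ (k + 1) + B i ^ (k + 1) := fun i k => by
    rw [← h i, (chebT_eval (A i) (B i) k).1]
  have hN := Matrix.det_permute' (finRotate (m + 1)) V'
  rw [sign_finRotate] at hN
  let c : Fin (m + 1) → F := fun j => if j = Fin.last m then - Sm / Ct else - Cc g D (m + 1) (j + 1) / Ct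
  have hM := Matrix.det_updateCol_sum (V'.submatrix id (finRotate (m + 1))) (Fin.last m) c
  have hMM : (Matrix.of fun i j : Fin (m + 1) => A i ^ ((j : ℕ) + 1) + B i ^ ((j : ℕ) + 1)) =
      (V'.submatrix id (finRotate (m + 1))).updateCol (Fin.last m) 
        (fun k => ∑ i, c i • (V'.submatrix id (finRotate (m + 1))) k i) := by
    ext i j
    rw [Matrix.updateCol_apply]
    split_ifs with hj
    · subst hj
      rw [Fin.sum_univ_castSucc]
      have h1 := hrel i
      rw [sum_range_succ, ← Fin.sum_univ_eq_sum_range (fun d => Cc g D (m + 1) (d + 1) * (A i ^ (d + 1) + B i ^ (d + 1)))] at h1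
      have h2 : ∀ d : Fin m, c d.castSucc • V'.submatrix id (finRotate (m + 1)) i d.castSucc = 
          (- Ct⁻¹) * (Cc g D (m + 1) ((d : ℕ) + 1) * (A i ^ ((d : ℕ) + 1) + B i ^ ((d : ℕ) + 1))) := by
        intro d
        have h3 : d.castSucc ≠ Fin.last m := Fin.castSucc_ne_last d
        simp only [c, if_neg h3, Matrix.submatrix_apply, id, V', Matrix.of_apply, smul_eq_mul]
        rw [coe_finRotate_of_ne_last h3, hT]
        simp only [Fin.val_castSucc]
        ring
      rw [sum_congr rfl fun d _ => h2 d, ← mul_sum]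
      simp only [c, Matrix.submatrix_apply, id, V', Matrix.of_apply, finRotate_last, smul_eq_mul, if_true, Fin.val_last]
      simp only [Fin.val_zero, chebT, Polynomial.eval_one]
      rw [← hCt] at h1
      field_simp
      linear_combination h1
    · simp only [Matrix.submatrix_apply, id, V', Matrix.of_apply]
      rw [coe_finRotate_of_ne_last hj, hT]
  rw [hMM, hM, hN, hV']
  simp only [c, if_true, smul_eq_mul]
  have : ∏ i, A i = (-1) ^ (m + 1) / Ct := by field_simp; linear_combination hC1
  rw [this]
  push_cast
  field_simp
  ring
end

section
variable {F : Type} [Field F]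

lemma qFact_ne {q : F} (h1 : ∀ k : ℕ, q ^ (k + 1) ≠ 1) (m : ℕ) : qFact q m ≠ 0 :=
  prod_ne_zero_iff.2 fun i _ => sub_ne_zero.2 (h1 i).symm

lemma qBinom_nat (q : F) (m k : ℕ) : qBinom q m (k : ℤ) =
    (∏ i ∈ range k, (1 - q ^ ((m : ℤ) - (i : ℤ)))) / qFact q k := by
  unfold qBinom; rw [if_neg (by omega), Int.toNat_natCast]

lemma qBinom_zero (q : F) (m : ℕ) : qBinom q m 0 = 1 := by
  simp [qBinom, qFact]

lemma qBinom_big (q : F) (m k : ℕ) (h : m < k) : qBinom q m (k : ℤ) = 0 := by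
  rw [qBinom_nat, prod_eq_zero (mem_range.2 h) (by simp), zero_div]

lemma qBinom_pascal {q : F} (h0 : q ≠ 0) (h1 : ∀ k : ℕ, q ^ (k + 1) ≠ 1) (m j : ℕ) :
    qBinom q (m + 1) ((j + 1 : ℕ) : ℤ) = qBinom q m ((j + 1 : ℕ) : ℤ) +
      q ^ ((m : ℤ) - j) * qBinom q m (j : ℤ) := by
  rw [qBinom_nat, qBinom_nat, qBinom_nat, prod_range_succ', prod_range_succ (n := j)]
  have e : ∏ k ∈ range j, (1 - q ^ (((m + 1 : ℕ) : ℤ) - ((k + 1 : ℕ) : ℤ))) = 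
      ∏ k ∈ range j, (1 - q ^ ((m : ℤ) - k)) :=
    prod_congr rfl fun k _ => by push_cast; ring_nf
  rw [e]
  have f : qFact q (j + 1) = qFact q j * (1 - q ^ (j + 1)) := by unfold qFact; rw [prod_range_succ]
  rw [f]
  have a := qFact_ne h1 j
  have b : 1 - q ^ (j + 1) ≠ 0 := sub_ne_zero.2 (h1 j).symm
  have z : q ^ (((m + 1 : ℕ) : ℤ) - ((0 : ℕ) : ℤ)) = q ^ ((m : ℤ) - j) * q ^ (j + 1) := by
    rw [← zpow_natCast q (j + 1), ← zpow_add₀ h0]; congr 1; push_cast; ring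
  rw [z]
  field_simp
  ring

lemma qbt {q : F} (h0 : q ≠ 0) (h1 : ∀ k : ℕ, q ^ (k + 1) ≠ 1) (m : ℕ) (s : F) :
    ∏ i ∈ range m, (1 - q ^ i * s) =
      ∑ k ∈ range (m + 1), (-1) ^ k * q ^ (k.choose 2) * qBinom q m (k : ℤ) * s ^ k := by
  induction m with
  | zero => simp [qBinom_zero]
  | succ m ih =>
    rw [prod_range_succ, ih]
    rw [sum_range_succ' _ (m + 1)]
    have : ∀ k ∈ range (m + 1), (-1) ^ (k + 1) * q ^ ((k + 1).choose 2) * qBinom q (m + 1) ((k + 1 : ℕ) : ℤ) * s ^ (k + 1) =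
      (-1) ^ (k + 1) * q ^ ((k + 1).choose 2) * qBinom q m ((k + 1 : ℕ) : ℤ) * s ^ (k + 1) -
      q ^ m * s * ((-1) ^ k * q ^ (k.choose 2) * qBinom q m (k : ℤ) * s ^ k) := by
      intro k hk
      rw [qBinom_pascal h0 h1]
      have : q ^ m = q ^ ((m : ℤ) - k) * q ^ k := by
        rw [← zpow_natCast q k, ← zpow_natCast q m, ← zpow_add₀ h0]; congr 1; ring
      rw [this, Nat.choose_succ_succ' k 1, Nat.choose_one_right, pow_add q k]
      ring
    rw [sum_congr rfl this, sum_sub_distrib, ← mul_sum]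
    have t := sum_range_succ' (fun k => (-1) ^ k * q ^ (k.choose 2) * qBinom q m (k : ℤ) * s ^ k) (m + 1)
    rw [sum_range_succ, qBinom_big q m (m + 1) (by omega)] at t
    have z : qBinom q (m + 1) ((0 : ℕ) : ℤ) = qBinom q m ((0 : ℕ) : ℤ) := by
      simp [qBinom_zero]
    rw [z]
    linear_combination t

/-- the coefficients of `∏ (1 - B_i t)` -/
def gco (q : F) (m a b k : ℕ) : F := (-1) ^ k * q ^ ((a + b + m) * k + k.choose 2) *
  (q ^ k * qBinom q m (k : ℤ) + q ^ (-(a : ℤ)) * qBinom q m ((k : ℤ) - 1))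

lemma gco_gen {q : F} (h0 : q ≠ 0) (h1 : ∀ k : ℕ, q ^ (k + 1) ≠ 1) (m a b : ℕ) (t : F) :
    ∑ k ∈ range (m + 2), gco q m a b k * t ^ k =
      (1 - q ^ (b + m) * t) * ∏ i ∈ range m, (1 - q ^ (a + b + m + 1 + i) * t) := by
  have e : ∏ i ∈ range m, (1 - q ^ (a + b + m + 1 + i) * t) =
      ∏ i ∈ range m, (1 - q ^ i * (q ^ (a + b + m + 1) * t)) :=
    prod_congr rfl fun i _ => by rw [pow_add q _ i]; ring
  rw [e, qbt h0 h1]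
  set f : ℕ → F := fun k => (-1) ^ k * q ^ (k.choose 2) * qBinom q m (k : ℤ) * (q ^ (a + b + m + 1) * t) ^ k with hf
  have s1 : ∑ k ∈ range (m + 2), gco q m a b k * t ^ k = ∑ k ∈ range (m + 2), f k +
      ∑ k ∈ range (m + 2), (-1) ^ k * q ^ ((a + b + m) * k + k.choose 2) *
        (q ^ (-(a : ℤ)) * qBinom q m ((k : ℤ) - 1)) * t ^ k := by
    rw [← sum_add_distrib]
    refine sum_congr rfl fun k _ => ?_
    simp only [gco, hf]
    rw [pow_add q ((a + b + m) * k), pow_mul q, mul_pow, pow_succ, mul_pow]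
    ring
  have s2 : ∑ k ∈ range (m + 2), f k = ∑ k ∈ range (m + 1), f k := by
    rw [sum_range_succ]; simp only [hf]; rw [qBinom_big q m (m + 1) (by omega)]; simp
  have s3 : ∑ k ∈ range (m + 2), (-1) ^ k * q ^ ((a + b + m) * k + k.choose 2) *
        (q ^ (-(a : ℤ)) * qBinom q m ((k : ℤ) - 1)) * t ^ k =
        - q ^ (b + m) * t * ∑ k ∈ range (m + 1), f k := by
    rw [sum_range_succ', mul_sum]
    have : qBinom q m (((0 : ℕ) : ℤ) - 1) = 0 := by simp [qBinom]
    rw [this]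
    simp only [mul_zero, zero_mul, add_zero]
    refine sum_congr rfl fun k _ => ?_
    simp only [hf]
    rw [show (((k + 1 : ℕ) : ℤ) - 1) = (k : ℤ) by push_cast; ring]
    have : q ^ ((a + b + m) * (k + 1) + (k + 1).choose 2) * q ^ (-(a : ℤ)) =
       q ^ (b + m) * q ^ (k.choose 2) * (q ^ (a + b + m + 1)) ^ k := by
      rw [zpow_neg, zpow_natCast, ← div_eq_mul_inv, div_eq_iff (pow_ne_zero _ h0), ← pow_mul, ← pow_add, ← pow_add, ← pow_add]
      congr 1
      rw [Nat.choose_succ_succ' k 1, Nat.choose_one_right]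
      ring
    rw [mul_pow, pow_succ t, pow_succ (-1 : F)]
    linear_combination (-(-1) ^ k * qBinom q m (k : ℤ) * t ^ k * t) * this
  rw [s1, s2, s3]
  ring

lemma gco_sq {q : F} (h0 : q ≠ 0) (m a b k : ℕ) : gco q m a b k ^ 2 * ((q ^ (a + b + 2 * m)) ^ k)⁻¹ =
    q ^ (k * (k + (a + b) - 1)) *
      (q ^ k * qBinom q m (k : ℤ) + q ^ (-(a : ℤ)) * qBinom q m ((k : ℤ) - 1)) ^ 2 := by
  unfold gco
  rw [mul_inv_eq_iff_eq_mul₀ (pow_ne_zero _ (pow_ne_zero _ h0))]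
  generalize (q ^ k * qBinom q m (k : ℤ) + q ^ (-(a : ℤ)) * qBinom q m ((k : ℤ) - 1)) = Y
  have e : (q ^ ((a + b + m) * k + k.choose 2)) ^ 2 = q ^ (k * (k + (a + b) - 1)) * (q ^ (a + b + 2 * m)) ^ k := by
    rw [← pow_mul, ← pow_mul, ← pow_add]
    congr 1
    rcases k with _ | k
    · simp
    · have h := Nat.choose_two_right (k + 1)
      have h2 : (k + 1).choose 2 * 2 = (k + 1) * k := by
        rw [h, Nat.add_sub_cancel]; exact Nat.div_mul_cancel (by simpa [mul_comm] using (Nat.even_mul_succ_self k).two_dvd)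
      have h3 : k + 1 + (a + b) - 1 = k + (a + b) := by omega
      rw [h3]
      linear_combination h2
  have s : ((-1 : F) ^ k) ^ 2 = 1 := by rw [← pow_mul, mul_comm, pow_mul]; simp
  rw [mul_pow, mul_pow, s, e]
  ring

lemma gco_zero (q : F) (m a b : ℕ) : gco q m a b 0 = 1 := by
  simp [gco, qBinom_zero]
  simp [qBinom]

lemma gco_top {q : F} (h0 : q ≠ 0) (h1 : ∀ k : ℕ, q ^ (k + 1) ≠ 1) (m a b : ℕ) :
    gco q m a b (m + 1) = (-1) ^ (m + 1) * (q ^ (b + m) * ∏ i ∈ range m, q ^ (a + b + m + 1 + i)) := by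
  have hmm : qBinom q m (m : ℤ) = 1 := by
    rw [qBinom_nat, div_eq_one_iff_eq (qFact_ne h1 m)]
    unfold qFact
    rw [← prod_range_reflect]
    refine prod_congr rfl fun i hi => ?_
    rw [mem_range] at hi
    rw [← zpow_natCast]
    congr 2
    omega
  unfold gco
  rw [qBinom_big q m (m + 1) (by omega), show (((m + 1 : ℕ) : ℤ) - 1) = (m : ℤ) by push_cast; ring, hmm,
    mul_zero, zero_add, mul_one, mul_assoc]
  congr 1
  rw [prod_pow_eq_pow_sum, sum_add_distrib, sum_const, card_range, sum_range_id, ← Nat.choose_two_right,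
    zpow_neg, zpow_natCast, ← div_eq_mul_inv, div_eq_iff (pow_ne_zero _ h0), ← pow_add, ← pow_add]
  congr 1
  rw [Nat.choose_succ_succ' m 1, Nat.choose_one_right]
  simp only [smul_eq_mul]
  ring
end

section
variable {F : Type} [Field F]

def eA (a m : ℕ) : ℕ → ℕ
  | 0 => a + m
  | k + 1 => m - 1 - k

def eB (a b m : ℕ) : ℕ → ℕ
  | 0 => b + m
  | k + 1 => a + b + m + 1 + k

lemma eA_cons (a m : ℕ) (i : Fin (m + 1)) :
    (Fin.cons (a + m) (fun i : Fin m => m - 1 - (i : ℕ)) : Fin (m + 1) → ℕ) i = eA a m i := by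
  refine Fin.cases ?_ (fun i => ?_) i <;> simp [eA]

lemma eB_cons (a b m : ℕ) (i : Fin (m + 1)) :
    (Fin.cons (b + m) (fun i : Fin m => a + b + m + 1 + (i : ℕ)) : Fin (m + 1) → ℕ) i = eB a b m i := by
  refine Fin.cases ?_ (fun i => ?_) i <;> simp [eB]

lemma eAB (a b m : ℕ) (i : Fin (m + 1)) : eA a m i + eB a b m i = a + b + 2 * m := by
  refine Fin.cases ?_ (fun i => ?_) i
  · simp [eA, eB]; ring
  · simp [eA, eB]; omega

lemma Mdet_q (q : F) (m a b : ℕ) (s : F) : Mdet (fun j : Fin (m + 1) => q ^ ((j : ℕ) + 1)) a b s =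
    Matrix.det (Matrix.of fun i j : Fin (m + 1) => (q ^ eA a m i) ^ ((j : ℕ) + 1) +
      s * (q ^ eB a b m i) ^ ((j : ℕ) + 1)) := by
  unfold Mdet
  congr 1
  ext i j
  simp only [Matrix.of_apply, eA_cons, eB_cons, ← pow_mul, mul_comm]

lemma Mdet_sum {q : F} (h0 : q ≠ 0) (h1 : ∀ k : ℕ, q ^ (k + 1) ≠ 1) (m a b : ℕ) :
    Mdet (fun j : Fin (m + 1) => q ^ ((j : ℕ) + 1)) a b 1 +
      Mdet (fun j : Fin (m + 1) => q ^ ((j : ℕ) + 1)) a b (-1) =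
    (∏ i ∈ range (m + 1), q ^ eA a m i) *
      (Matrix.vandermonde fun i : Fin (m + 1) => q ^ eA a m i + q ^ eB a b m i).det *
    ((∑ k ∈ range (m + 2), q ^ (k * (k + (a + b) - 1)) *
      (q ^ k * qBinom q m (k : ℤ) + q ^ (-(a : ℤ)) * qBinom q m ((k : ℤ) - 1)) ^ 2) +
      (1 - q ^ ((b : ℤ) - a)) * ∏ i ∈ range m, (1 - q ^ (a + b + 2 * (i + 1)))) := by
  have hD : ∀ i : Fin (m + 1), q ^ eA a m i * q ^ eB a b m i = q ^ (a + b + 2 * m) := fun i => by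
    rw [← pow_add, eAB]
  have p := det_plus (fun i : Fin (m + 1) => q ^ eA a m i) (fun i => q ^ eB a b m i) (q ^ (a + b + 2 * m))
    (pow_ne_zero _ h0) hD (gco q m a b) (fun t => by
      rw [gco_gen h0 h1, Fin.prod_univ_succ, ← Fin.prod_univ_eq_prod_range (fun i => 1 - q ^ (a + b + m + 1 + i) * t)]
      simp [eB]) (gco_zero q m a b) (by
      rw [gco_top h0 h1, Fin.prod_univ_succ, ← Fin.prod_univ_eq_prod_range (fun i => q ^ (a + b + m + 1 + i))]
      simp [eB])
  have n := det_minus (fun i : Fin (m + 1) => q ^ eA a m i) (fun i => q ^ eB a b m i) (q ^ (a + b + 2 * m)) hD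
  rw [Mdet_q, Mdet_q]
  simp only [one_mul, neg_mul, ← sub_eq_add_neg]
  rw [p, n, sum_congr rfl fun k _ => gco_sq h0 m a b k]
  have e : ∏ i : Fin (m + 1), (q ^ eA a m i - q ^ eB a b m i) = (∏ i : Fin (m + 1), q ^ eA a m i) *
      ((1 - q ^ ((b : ℤ) - a)) * ∏ i ∈ range m, (1 - q ^ (a + b + 2 * (i + 1)))) := by
    rw [← Fin.prod_univ_eq_prod_range (fun i => (1 - q ^ (a + b + 2 * (i + 1)))), Fin.prod_univ_succ, Fin.prod_univ_succ (f := fun i : Fin (m + 1) => q ^ eA a m i),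
      mul_mul_mul_comm, ← prod_mul_distrib]
    congr 1
    · simp only [Fin.val_zero, eA, eB]
      rw [mul_sub, mul_one, ← zpow_natCast q (a + m), ← zpow_natCast q (b + m), ← zpow_add₀ h0]
      congr 2
      push_cast; ring
    · refine prod_congr rfl fun i _ => ?_
      simp only [Fin.val_succ, eA, eB]
      rw [mul_sub, mul_one, ← pow_add]
      congr 2
      omega
  rw [e, ← Fin.prod_univ_eq_prod_range (fun i => q ^ eA a m i)]
  ring

lemma pairs_range (n : ℕ) (f : ℕ → ℕ → F) : ∏ i : Fin n, ∏ j : Fin n, (if i < j then f i j else 1) =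
    ∏ j ∈ range n, ∏ i ∈ range j, f i j := by
  rw [prod_comm, ← Fin.prod_univ_eq_prod_range (fun j => ∏ i ∈ range j, f i j)]
  refine prod_congr rfl fun j _ => ?_
  have := Fin.prod_univ_eq_prod_range (fun i => if i < (j : ℕ) then f i j else 1) n
  simp only [← Fin.lt_def] at this
  rw [this, ← prod_filter]
  congr 1
  ext i
  have := j.2
  simp; omega

lemma range_shift (m : ℕ) (f : ℕ → ℕ → F) : ∏ j ∈ range (m + 1), ∏ i ∈ range j, f i j =
    (∏ j ∈ range m, f 0 (j + 1)) * ∏ j ∈ range m, ∏ i ∈ range j, f (i + 1) (j + 1) := by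
  rw [prod_range_succ', range_zero, prod_empty, mul_one, ← prod_mul_distrib]
  refine prod_congr rfl fun j _ => ?_
  rw [prod_range_succ', mul_comm]

lemma qBinom_fact {q : F} (h1 : ∀ k : ℕ, q ^ (k + 1) ≠ 1) (c m : ℕ) :
    qBinom q (c + m) (c : ℤ) * qFact q m = ∏ j ∈ range m, (1 - q ^ (c + 1 + j)) := by
  rw [qBinom_nat]
  have e1 : ∏ i ∈ range c, (1 - q ^ (((c + m : ℕ) : ℤ) - (i : ℤ))) = ∏ i ∈ range c, (1 - q ^ (m + i + 1)) := by
    rw [← prod_range_reflect]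
    refine prod_congr rfl fun i hi => ?_
    rw [mem_range] at hi
    rw [← zpow_natCast]
    congr 2
    omega
  have e2 : qFact q (m + c) = qFact q m * ∏ i ∈ range c, (1 - q ^ (m + i + 1)) := by
    unfold qFact; rw [prod_range_add]
  have e3 : qFact q (c + m) = qFact q c * ∏ i ∈ range m, (1 - q ^ (c + i + 1)) := by
    unfold qFact; rw [prod_range_add]
  have e4 : ∏ j ∈ range m, (1 - q ^ (c + 1 + j)) = ∏ i ∈ range m, (1 - q ^ (c + i + 1)) :=
    prod_congr rfl fun i _ => by ring_nf
  rw [e1, e4, div_mul_eq_mul_div, div_eq_iff (qFact_ne h1 c)]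
  rw [add_comm m c, e3] at e2
  linear_combination -e2

lemma pow_count (m : ℕ) : 2 * ∑ j ∈ range m, (m - 1 - j) + ∑ j ∈ range m, ∑ i ∈ range j, (m - 1 - j) + m =
    ∑ j ∈ range (m + 1), ∑ i ∈ range j, (i + 1) := by
  have a1 : ∀ (M : ℤ) (n : ℕ), 2 * ∑ j ∈ range n, (M - 1 - (j : ℤ)) = 2 * n * (M - 1) - n * (n - 1) := by
    intro M n
    induction n with
    | zero => simp
    | succ n ih => rw [sum_range_succ, mul_add, ih]; push_cast; ring
  have a2 : ∀ (M : ℤ) (n : ℕ), 6 * ∑ j ∈ range n, (j : ℤ) * (M - 1 - (j : ℤ)) =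
      3 * (M - 1) * n * (n - 1) - n * (n - 1) * (2 * n - 1) := by
    intro M n
    induction n with
    | zero => simp
    | succ n ih => rw [sum_range_succ, mul_add, ih]; push_cast; ring
  have a3 : ∀ n : ℕ, 2 * ∑ i ∈ range n, ((i : ℤ) + 1) = n * (n + 1) := by
    intro n
    induction n with
    | zero => simp
    | succ n ih => rw [sum_range_succ, mul_add, ih]; push_cast; ring
  have a4 : ∀ n : ℕ, 6 * ∑ j ∈ range (n + 1), ∑ i ∈ range j, ((i : ℤ) + 1) = n * (n + 1) * (n + 2) := by
    intro n
    induction n with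
    | zero => simp
    | succ n ih => rw [sum_range_succ, mul_add, ih]; have := a3 (n + 1); push_cast at this ⊢; linear_combination 3 * this
  have c1 : ((∑ j ∈ range m, (m - 1 - j) : ℕ) : ℤ) = ∑ j ∈ range m, ((m : ℤ) - 1 - j) := by
    rw [Nat.cast_sum]; refine sum_congr rfl fun j hj => ?_
    rw [mem_range] at hj; omega
  have c2 : ((∑ j ∈ range m, ∑ i ∈ range j, (m - 1 - j) : ℕ) : ℤ) = ∑ j ∈ range m, (j : ℤ) * ((m : ℤ) - 1 - j) := by
    rw [Nat.cast_sum]; refine sum_congr rfl fun j hj => ?_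
    rw [mem_range] at hj; rw [sum_const, card_range, smul_eq_mul, Nat.cast_mul]; congr 1; omega
  zify
  have b1 := a1 m m
  have b2 := a2 m m
  have b4 := a4 m
  rw [← c1] at b1
  rw [← c2] at b2
  push_cast at b1 b2 ⊢
  linarith

lemma const_eq {q : F} (h1 : ∀ k : ℕ, q ^ (k + 1) ≠ 1) (m a b : ℕ) :
    (∏ i ∈ range (m + 1), q ^ eA a m i) *
      (Matrix.vandermonde fun i : Fin (m + 1) => q ^ eA a m i + q ^ eB a b m i).det *
      qBinom q (a + b + m) ((a + b : ℕ) : ℤ) =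
    Vd (fun j : Fin (m + 1) => q ^ ((j : ℕ) + 1)) * q ^ a * qBinom q (a + m) (a : ℤ) * qBinom q (b + m) (b : ℤ) *
      ∏ j ∈ range (m + 1), ∏ i ∈ range j, (1 - q ^ (a + b + i + j)) := by
  set w : ℕ → F := fun k => q ^ eA a m k + q ^ eB a b m k with hw
  have v1 : (Matrix.vandermonde fun i : Fin (m + 1) => q ^ eA a m i + q ^ eB a b m i).det =
      ∏ j ∈ range (m + 1), ∏ i ∈ range j, (w j - w i) := by
    rw [Matrix.det_vandermonde, ← pairs_range (m + 1) (fun i j => w j - w i)]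
    refine prod_congr rfl fun i _ => ?_
    rw [← prod_filter]
    congr 1
    ext j; simp
  have v2 : ∏ j ∈ range m, (w (j + 1) - w 0) = (∏ j ∈ range m, q ^ (m - 1 - j)) *
      (∏ j ∈ range m, (1 - q ^ (a + 1 + j))) * ∏ j ∈ range m, (1 - q ^ (b + 1 + j)) := by
    rw [← prod_mul_distrib, ← prod_mul_distrib]
    refine prod_congr rfl fun j hj => ?_
    rw [mem_range] at hj
    obtain ⟨d, rfl⟩ := Nat.exists_eq_add_of_lt hj
    simp only [hw, eA, eB]
    have : j + d + 1 - 1 - j = d := by omega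
    rw [this]; ring
  have v3 : ∏ j ∈ range m, ∏ i ∈ range j, (w (j + 1) - w (i + 1)) =
      (∏ j ∈ range m, ∏ i ∈ range j, q ^ (m - 1 - j)) * (∏ j ∈ range m, ∏ i ∈ range j, (1 - q ^ (j - i))) *
      ∏ j ∈ range m, ∏ i ∈ range j, (1 - q ^ (a + b + (i + 1) + (j + 1))) := by
    simp_rw [← prod_mul_distrib]
    refine prod_congr rfl fun j hj => prod_congr rfl fun i hi => ?_
    rw [mem_range] at hj hi
    obtain ⟨d, rfl⟩ := Nat.exists_eq_add_of_lt hj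
    obtain ⟨e, rfl⟩ := Nat.exists_eq_add_of_lt hi
    simp only [hw, eA, eB]
    have e1 : i + e + 1 + d + 1 - 1 - (i + e + 1) = d := by omega
    have e2 : i + e + 1 + d + 1 - 1 - i = d + e + 1 := by omega
    have e3 : i + e + 1 - i = e + 1 := by omega
    rw [e1, e2, e3]; ring
  have x1 : Vd (fun j : Fin (m + 1) => q ^ ((j : ℕ) + 1)) = (∏ j ∈ range (m + 1), ∏ i ∈ range j, q ^ (i + 1)) *
      ((∏ j ∈ range m, ∏ i ∈ range j, (1 - q ^ (j - i))) * qFact q m) := by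
    have : qFact q m = ∏ i ∈ range m, (1 - q ^ (m - i)) := by
      unfold qFact
      rw [← prod_range_reflect]
      refine prod_congr rfl fun i hi => ?_
      rw [mem_range] at hi
      congr 2; omega
    rw [this, ← prod_range_succ (fun j => ∏ i ∈ range j, (1 - q ^ (j - i)))]
    unfold Vd
    rw [pairs_range (m + 1) (fun i j => q ^ (i + 1) - q ^ (j + 1))]
    simp_rw [← prod_mul_distrib]
    refine prod_congr rfl fun j _ => prod_congr rfl fun i hi => ?_
    rw [mem_range] at hi
    rw [mul_sub, mul_one, ← pow_add]
    congr 2; omega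
  have A1 : ∏ i ∈ range (m + 1), q ^ eA a m i = (∏ j ∈ range m, q ^ (m - 1 - j)) * (q ^ a * q ^ m) := by
    rw [prod_range_succ']; simp only [eA, pow_add]
  have q0 : ∏ j ∈ range m, (1 - q ^ (a + b + 0 + (j + 1))) = ∏ j ∈ range m, (1 - q ^ (a + b + 1 + j)) :=
    prod_congr rfl fun j _ => by ring_nf
  have pc : (∏ j ∈ range m, q ^ (m - 1 - j)) ^ 2 * (∏ j ∈ range m, ∏ i ∈ range j, q ^ (m - 1 - j)) * q ^ m =
      ∏ j ∈ range (m + 1), ∏ i ∈ range j, q ^ (i + 1) := by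
    simp_rw [prod_pow_eq_pow_sum]
    rw [← pow_mul, ← pow_add, ← pow_add, ← pow_count m, mul_comm]
  rw [v1, range_shift m (fun i j => w j - w i), v2, v3, x1, range_shift m (fun i j => 1 - q ^ (a + b + i + j)), q0,
    ← qBinom_fact h1 a m, ← qBinom_fact h1 b m, ← qBinom_fact h1 (a + b) m, A1, ← pc]
  ring

lemma PP_q (q : F) (n : ℕ) : PP (fun j : Fin n => q ^ ((j : ℕ) + 1)) univ =
    ∏ j ∈ range n, ∏ i ∈ range j, (1 - q ^ (i + j + 2)) := by
  unfold PP
  rw [← pairs_range n (fun i j => 1 - q ^ (i + j + 2))]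
  refine prod_congr rfl fun i _ => prod_congr rfl fun j _ => ?_
  congr 2
  rw [← pow_add]; congr 1; ring

lemma gen_q {q : F} (h0 : q ≠ 0) (h1 : ∀ k : ℕ, q ^ (k + 1) ≠ 1) (n : ℕ) :
    Gen (fun j : Fin n => q ^ ((j : ℕ) + 1)) := by
  refine ⟨fun i => pow_ne_zero _ h0, ?_, fun i j => ?_⟩
  · have key : ∀ i j : Fin n, i < j → q ^ ((i : ℕ) + 1) ≠ q ^ ((j : ℕ) + 1) := by
      intro i j hij h
      have hij' : (i : ℕ) < j := hij
      obtain ⟨d, hd⟩ := Nat.exists_eq_add_of_lt hij'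
      apply h1 d
      have : q ^ ((j : ℕ) + 1) = q ^ ((i : ℕ) + 1) * q ^ (d + 1) := by rw [← pow_add]; congr 1; omega
      rw [this] at h
      exact (mul_left_cancel₀ (pow_ne_zero _ h0) (by rw [mul_one]; exact h.symm))
    intro i j h
    rcases lt_trichotomy i j with hh | hh | hh
    · exact absurd h (key i j hh)
    · exact hh
    · exact absurd h.symm (key j i hh)
  · rw [← pow_add]
    exact h1 (i + 1 + j)

theorem GG_final {q : F} (h2 : (2 : F) ≠ 0) (h0 : q ≠ 0) (h1 : ∀ k : ℕ, q ^ (k + 1) ≠ 1) (m a b : ℕ) :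
    GG (fun j : Fin (m + 1) => q ^ ((j : ℕ) + 1)) univ a b = q ^ a *
      (qBinom q (a + m) (a : ℤ) * qBinom q (b + m) (b : ℤ) / (2 * qBinom q (a + b + m) ((a + b : ℕ) : ℤ))) *
      (∏ j ∈ range (m + 1), ∏ i ∈ range j, ((1 - q ^ (a + b + i + j)) / (1 - q ^ (i + j + 2)))) *
    ((∑ k ∈ range (m + 2), q ^ (k * (k + (a + b) - 1)) *
      (q ^ k * qBinom q m (k : ℤ) + q ^ (-(a : ℤ)) * qBinom q m ((k : ℤ) - 1)) ^ 2) +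
      (1 - q ^ ((b : ℤ) - a)) * ∏ i ∈ range m, (1 - q ^ (a + b + 2 * (i + 1)))) := by
  have hx := gen_q h0 h1 (m + 1)
  have g := GG_det _ hx a b
  rw [Mdet_sum h0 h1] at g
  have c := const_eq h1 m a b
  have hV := Vd_ne _ hx.inj
  have hP := PP_ne hx univ
  have hb : qBinom q (a + b + m) ((a + b : ℕ) : ℤ) ≠ 0 := by
    intro h
    have := qBinom_fact h1 (a + b) m
    rw [h, zero_mul] at this
    exact (prod_ne_zero_iff.2 fun j _ => sub_ne_zero.2 (by
      rw [show a + b + 1 + j = (a + b + j) + 1 by ring]; exact (h1 _).symm)) this.symm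
  simp_rw [prod_div_distrib]
  rw [← PP_q q (m + 1)]
  generalize PP (fun j : Fin (m + 1) => q ^ ((j : ℕ) + 1)) univ = P at *
  generalize Vd (fun j : Fin (m + 1) => q ^ ((j : ℕ) + 1)) = V at *
  generalize GG (fun j : Fin (m + 1) => q ^ ((j : ℕ) + 1)) univ a b = G at *
  generalize qBinom q (a + b + m) ((a + b : ℕ) : ℤ) = b3 at *
  generalize (∑ k ∈ range (m + 2), q ^ (k * (k + (a + b) - 1)) *
      (q ^ k * qBinom q m (k : ℤ) + q ^ (-(a : ℤ)) * qBinom q m ((k : ℤ) - 1)) ^ 2) +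
      (1 - q ^ ((b : ℤ) - a)) * ∏ i ∈ range m, (1 - q ^ (a + b + 2 * (i + 1))) = Z at *
  generalize ∏ j ∈ range (m + 1), ∏ i ∈ range j, (1 - q ^ (a + b + i + j)) = Q at *
  generalize qBinom q (a + m) (a : ℤ) = b1 at *
  generalize qBinom q (b + m) (b : ℤ) = b2 at *
  field_simp
  apply mul_left_cancel₀ hV
  linear_combination b3 * g + Z * c
end

lemma qq_ne : qq ≠ 0 := RatFunc.X_ne_zero

lemma qq_pow (k : ℕ) : qq ^ (k + 1) ≠ 1 := by
  intro h
  have h' : (algebraMap (Polynomial ℚ) (RatFunc ℚ)) (Polynomial.X ^ (k + 1)) = algebraMap (Polynomial ℚ) (RatFunc ℚ) 1 := by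
    rw [map_pow, RatFunc.algebraMap_X, map_one]; exact h
  have := RatFunc.algebraMap_injective ℚ h'
  have := congrArg Polynomial.natDegree this
  simp at this

theorem lhs_eq (n a b : ℕ) : 
    (∑ T ∈ ((Fintype.piFinset fun _ : Fin n =>
          Fintype.piFinset fun _ : Fin (a + b) => Finset.range (n + 1)).filter
        (fun T => IsTab n (a + b) T ∧ oddColsTab n (a + b) T = a)),
      qq ^ sumTab n (a + b) T) = R (fun j : Fin n => qq ^ ((j : ℕ) + 1)) n univ a b := by
  have hx := gen_q qq_ne qq_pow n
  have hV := Vd_ne _ hx.inj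
  rw [start]
  apply mul_right_cancel₀ hV
  have := Lsum_R _ hx.inj n (Function.Embedding.refl (Fin n)) a b
  simp only [Function.Embedding.refl_apply, map_refl] at this
  rw [mul_comm (R _ _ _ _ _), ← this, sum_mul]
  refine sum_congr rfl fun l hl => ?_
  rw [mem_Lset] at hl
  have z := Z_bial qq n (a + b) n le_rfl l hl.2.1 hl.1
  have e : ext0 n l = l := by
    funext i; simp [ext0]
  rw [e] at z
  exact z

/-- generating function for tableaux with entries in `{1,…,n}`,
at most `c` columns, exactly `p` of which are odd. -/
theorem genfun_tableaux_odd_columns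
    (n c p : ℕ) (hn : 1 ≤ n) (hp : p ≤ c) :
    (∑ T ∈ ((Fintype.piFinset fun _ : Fin n =>
          Fintype.piFinset fun _ : Fin c => Finset.range (n + 1)).filter
        (fun T => IsTab n c T ∧ oddColsTab n c T = p)),
      qq ^ sumTab n c T)
    = qq ^ p *
      (qBinom qq (p + n - 1) (p : ℤ) * qBinom qq (c - p + n - 1) ((c : ℤ) - p) /
        (2 * qBinom qq (c + n - 1) (c : ℤ))) *
      (∏ j ∈ Finset.range n, ∏ i ∈ Finset.range j,
        ((1 - qq ^ (c + i + j)) / (1 - qq ^ (i + j + 2)))) *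
      ((∑ k ∈ Finset.range (n + 1),
          qq ^ (k * (k + c - 1)) *
            (qq ^ k * qBinom qq (n - 1) (k : ℤ) +
              qq ^ (-(p : ℤ)) * qBinom qq (n - 1) ((k : ℤ) - 1)) ^ 2) +
        (1 - qq ^ ((c : ℤ) - 2 * p)) *
          ∏ i ∈ Finset.range (n - 1), (1 - qq ^ (c + 2 * (i + 1)))) := by
  obtain ⟨m, rfl⟩ : ∃ m, n = m + 1 := ⟨n - 1, by omega⟩
  obtain ⟨b, rfl⟩ := Nat.exists_eq_add_of_le hp
  rw [lhs_eq, R_eq_GG two_ne_zero (gen_q qq_ne qq_pow (m + 1)) m univ (by simp),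
    GG_final two_ne_zero qq_ne qq_pow m p b]
  have e1 : p + (m + 1) - 1 = p + m := by omega
  have e2 : p + b - p + (m + 1) - 1 = b + m := by omega
  have e3 : p + b + (m + 1) - 1 = p + b + m := by omega
  have e4 : m + 1 - 1 = m := by omega
  have e5 : ((p + b : ℕ) : ℤ) - p = b := by push_cast; ring
  have e6 : ((p + b : ℕ) : ℤ) - 2 * p = (b : ℤ) - p := by push_cast; ring
  rw [e1, e2, e3, e4, e5, e6]

end
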